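/- arXiv:1809.02773 — 3 statements merged into one kernel-verified Lean document; each statement's English description precedes it below -/
import Mathlib

section
/- Let a, z, x ∈ ℝⁿ with z ≠ 0, set h = z − x, and let τ_z, τ_h, τ_x > 0. Suppose ‖h‖ ≤ ‖z‖/11, |a⊤z| ≤ τ_z·‖z‖, |a⊤x| ≤ 1.1·τ_x·‖x‖, and |(a⊤x)² − (a⊤z)²| ≤ 3·τ_h·‖h‖·(|a⊤z| + |a⊤x|). Then |a⊤h| ≤ τ_{h,z}·‖z‖, where τ_{h,z} = τ_z + (0.3·τ_h·(τ_z + 1.2·τ_x) + τ_z²)^{1/2}. -/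
/-- Euclidean norm on `Fin n → ℝ`. -/
noncomputable def vecNorm {n : ℕ} (v : Fin n → ℝ) : ℝ := Real.sqrt (∑ i, (v i)^2)

/-- Euclidean inner product on `Fin n → ℝ`. -/
def dotp {n : ℕ} (v w : Fin n → ℝ) : ℝ := ∑ i, v i * w i

theorem vecNorm_eq_norm {n : ℕ} (v : Fin n → ℝ) : vecNorm v = ‖WithLp.toLp 2 v‖ := by
  simp [vecNorm, EuclideanSpace.norm_eq]

/-- On the intersection of the truncation events and under the closeness condition
`‖h‖ ≤ ‖z‖/11` (with `h = z − x`), one has `|aᵀh| ≤ τ_{h,z}‖z‖`, where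
`τ_{h,z} = τ_z + (0.3τ_h(τ_z + 1.2τ_x) + τ_z²)^{1/2}`. -/
theorem truncation_implies_h_bound (n : ℕ) (a z x : Fin n → ℝ) (hz : z ≠ 0)
    (τz τh τx : ℝ) (hτz : 0 < τz) (hτh : 0 < τh) (hτx : 0 < τx)
    (hclose : vecNorm (z - x) ≤ vecNorm z / 11)
    (h1 : |dotp a z| ≤ τz * vecNorm z)
    (h2 : |dotp a x| ≤ 1.1 * τx * vecNorm x)
    (h3 : |(dotp a x)^2 - (dotp a z)^2|
      ≤ 3 * τh * vecNorm (z - x) * (|dotp a z| + |dotp a x|)) :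
    |dotp a (z - x)|
      ≤ (τz + Real.sqrt (0.3 * τh * (τz + 1.2 * τx) + τz^2)) * vecNorm z := by
  have hN : 0 ≤ vecNorm z := Real.sqrt_nonneg _
  have hx : vecNorm x ≤ 12 / 11 * vecNorm z := by
    have : vecNorm x ≤ vecNorm z + vecNorm (z - x) := by
      simp only [vecNorm_eq_norm, WithLp.toLp_sub]
      have h := norm_sub_le (WithLp.toLp 2 z) (WithLp.toLp 2 z - WithLp.toLp 2 x)
      rwa [sub_sub_cancel] at h
    linarith
  have hd : dotp a (z - x) = dotp a z - dotp a x := by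
    simp [dotp, mul_sub, Finset.sum_sub_distrib]
  have hax : |dotp a x| ≤ 1.2 * τx * vecNorm z := by
    have := mul_le_mul_of_nonneg_left hx (by positivity : 0 ≤ 1.1 * τx)
    linarith
  have hprod : 3 * τh * vecNorm (z - x) * (|dotp a z| + |dotp a x|)
      ≤ 3 * τh * (vecNorm z / 11) * (τz * vecNorm z + 1.2 * τx * vecNorm z) := by
    gcongr
  have hP : 0 ≤ τh * (τz + 1.2 * τx) * vecNorm z ^ 2 := by positivity
  have hsq : (dotp a z) ^ 2 ≤ (τz * vecNorm z) ^ 2 := by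
    rw [← sq_abs]
    gcongr
  have hfin : (dotp a x) ^ 2 ≤ (0.3 * τh * (τz + 1.2 * τx) + τz^2) * vecNorm z ^ 2 := by
    have h4 := (le_abs_self _).trans (h3.trans hprod)
    linarith
  have hS : |dotp a x| ≤ Real.sqrt (0.3 * τh * (τz + 1.2 * τx) + τz^2) * vecNorm z := by
    refine abs_le_of_sq_le_sq ?_ (by positivity)
    rw [mul_pow, Real.sq_sqrt (by positivity)]
    exact hfin
  rw [hd, add_mul]
  exact (norm_sub_le (dotp a z) (dotp a x)).trans (add_le_add h1 hS)
end

section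
/- There exist absolute constants c > 0, C > 0 and ε̄ ∈ (0,1) such that for every γ ≥ 1 and every ε ∈ (0, ε̄) the following holds: if m and n are positive integers with m ≥ C·ε^{−2}·log(ε^{−1})·n, and a₁, …, a_m are independent standard Gaussian vectors in ℝⁿ, then with probability at least 1 − e^{−c·m·ε²}, the spectral norm bound ‖(1/m)·Σ_{k=1}^m a_k a_k⊤·1{|a_k⊤z| > γ‖z‖}‖ ≤ 5γ·e^{−0.49γ²} + ε holds simultaneously for all nonzero z ∈ ℝⁿ. -/
open Matrix MeasureTheory ProbabilityTheory

attribute [local instance] Classical.propDecidable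

/-- Standard Gaussian measure `N(0, Iₙ)` on `ℝⁿ`. -/
noncomputable def stdGaussianVec (n : ℕ) : Measure (Fin n → ℝ) :=
  Measure.pi fun _ => gaussianReal 0 1

/-- The distribution of `m` independent standard Gaussian vectors in `ℝⁿ`. -/
noncomputable def sampleMeasure (m n : ℕ) : Measure (Fin m → Fin n → ℝ) :=
  Measure.pi fun _ => stdGaussianVec n

/-- Truncated square. -/
noncomputable def trF (γ t : ℝ) : ℝ := if γ < |t| then t ^ 2 else 0

lemma trF_nonneg (γ t : ℝ) : 0 ≤ trF γ t := by
  unfold trF; split_ifs <;> positivity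

lemma trF_le (γ t : ℝ) : trF γ t ≤ t ^ 2 := by
  unfold trF; split_ifs <;> [exact le_rfl; positivity]

lemma measurable_trF (γ : ℝ) : Measurable (trF γ) := by
  unfold trF
  exact Measurable.ite (measurableSet_lt measurable_const (by fun_prop)) (by fun_prop)
    measurable_const

lemma tail_integral (τ : ℝ) (hτ : 0 < τ) :
    ∫ x in Set.Ioi τ, Real.exp (-x ^ 2 / 2) * x ^ 2 ≤ (τ + 1 / τ) * Real.exp (-τ ^ 2 / 2) := by
  have hd : ∀ x ∈ Set.Ici τ, HasDerivAt (fun x : ℝ => -((x + 1 / x) * Real.exp (-x ^ 2 / 2)))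
      ((x ^ 2 + 1 / x ^ 2) * Real.exp (-x ^ 2 / 2)) x := by
    intro x hx
    have hx0 : x ≠ 0 := (lt_of_lt_of_le hτ hx).ne'
    have h1 : HasDerivAt (fun x : ℝ => x + 1 / x) (1 + -(x ^ 2)⁻¹) x := by
      simp only [one_div]
      exact (hasDerivAt_id x).add (hasDerivAt_inv hx0)
    have h2 : HasDerivAt (fun x : ℝ => Real.exp (-x ^ 2 / 2)) (Real.exp (-x ^ 2 / 2) * (-x)) x := by
      have : HasDerivAt (fun x : ℝ => -x ^ 2 / 2) (-x) x := by
        have := ((hasDerivAt_pow 2 x).neg).div_const 2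
        refine this.congr_deriv ?_
        norm_num
        linarith
      exact this.exp
    refine (h1.mul h2).neg.congr_deriv ?_
    field_simp
    ring
  have hnn : ∀ x ∈ Set.Ioi τ, 0 ≤ (x ^ 2 + 1 / x ^ 2) * Real.exp (-x ^ 2 / 2) := by
    intro x _; positivity
  have hE : Filter.Tendsto (fun x : ℝ => x * Real.exp (-x ^ 2 / 2)) Filter.atTop (nhds 0) := by
    have h := Real.tendsto_pow_mul_exp_neg_atTop_nhds_zero 1
    refine tendsto_of_tendsto_of_tendsto_of_le_of_le' tendsto_const_nhds h ?_ ?_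
    · filter_upwards [Filter.eventually_ge_atTop 2] with x hx
      positivity
    · filter_upwards [Filter.eventually_ge_atTop 2] with x hx
      rw [pow_one]
      gcongr
      nlinarith
  have ht : Filter.Tendsto (fun x : ℝ => -((x + 1 / x) * Real.exp (-x ^ 2 / 2))) Filter.atTop
      (nhds 0) := by
    rw [← neg_zero]
    apply Filter.Tendsto.neg
    have h2 : Filter.Tendsto (fun x : ℝ => 2 * (x * Real.exp (-x ^ 2 / 2))) Filter.atTop
      (nhds 0) := by simpa using hE.const_mul 2
    refine tendsto_of_tendsto_of_tendsto_of_le_of_le' tendsto_const_nhds h2 ?_ ?_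
    · filter_upwards [Filter.eventually_ge_atTop 2] with x hx
      positivity
    · filter_upwards [Filter.eventually_ge_atTop 2] with x hx
      rw [← mul_assoc]
      gcongr
      have : 1 / x ≤ 1 := by rw [div_le_one (by linarith)]; linarith
      linarith
  have hint := integrableOn_Ioi_deriv_of_nonneg' hd hnn ht
  have hval := integral_Ioi_of_hasDerivAt_of_nonneg' hd hnn ht
  have : ∫ x in Set.Ioi τ, Real.exp (-x ^ 2 / 2) * x ^ 2 ≤
      ∫ x in Set.Ioi τ, (x ^ 2 + 1 / x ^ 2) * Real.exp (-x ^ 2 / 2) := by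
    apply integral_mono_of_nonneg
    · exact Filter.Eventually.of_forall fun x => by positivity
    · exact hint
    · refine Filter.Eventually.of_forall fun x => ?_
      have : 0 ≤ 1 / x ^ 2 * Real.exp (-x ^ 2 / 2) := by positivity
      simp only
      nlinarith
  rw [hval] at this
  linarith

lemma pdf_eq (x : ℝ) : gaussianPDFReal 0 1 x = (Real.sqrt (2 * Real.pi))⁻¹ * Real.exp (-x ^ 2 / 2) := by
  simp [gaussianPDFReal]

lemma sqrt_two_pi_ge : (2.5 : ℝ) ≤ Real.sqrt (2 * Real.pi) := by
  apply Real.le_sqrt_of_sq_le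
  nlinarith [Real.pi_gt_d2]

lemma expect_trF (τ : ℝ) (hτ : 0 < τ) :
    ∫ x, trF τ x ∂(gaussianReal 0 1) ≤ 0.8 * ((τ + 1 / τ) * Real.exp (-τ ^ 2 / 2)) := by
  rw [integral_gaussianReal_eq_integral_smul (by norm_num)]
  have h1 : (fun x : ℝ => gaussianPDFReal 0 1 x • trF τ x) =
      fun x => (Real.sqrt (2 * Real.pi))⁻¹ * ((fun y => Real.exp (-y ^ 2 / 2) * trF τ y) |x|) := by
    funext x
    simp only [pdf_eq, smul_eq_mul, sq_abs, trF, abs_abs]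
    ring
  rw [h1, integral_const_mul, integral_comp_abs (f := fun y => Real.exp (-y ^ 2 / 2) * trF τ y)]
  have h2 : ∫ x in Set.Ioi (0:ℝ), Real.exp (-x ^ 2 / 2) * trF τ x =
      ∫ x in Set.Ioi τ, Real.exp (-x ^ 2 / 2) * x ^ 2 := by
    rw [← integral_indicator measurableSet_Ioi, ← integral_indicator measurableSet_Ioi]
    congr 1
    funext x
    simp only [Set.indicator, Set.mem_Ioi, trF]
    by_cases h : 0 < x
    · rw [abs_of_pos h]; simp only [h, if_true]; split_ifs <;> simp
    · have : ¬ τ < x := by linarith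
      simp [h, this]
  rw [h2]
  have h3 := tail_integral τ hτ
  have h4 := sqrt_two_pi_ge
  have h5 : (Real.sqrt (2 * Real.pi))⁻¹ ≤ 0.4 := by
    rw [inv_le_comm₀ (by positivity) (by norm_num)]; norm_num at h4 ⊢; linarith
  have h6 : 0 ≤ (τ + 1 / τ) * Real.exp (-τ ^ 2 / 2) := by positivity
  have h7 : 0 ≤ (Real.sqrt (2 * Real.pi))⁻¹ := by positivity
  calc _ ≤ (Real.sqrt (2 * Real.pi))⁻¹ * (2 * ((τ + 1 / τ) * Real.exp (-τ ^ 2 / 2))) := by gcongr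
    _ ≤ 0.4 * (2 * ((τ + 1 / τ) * Real.exp (-τ ^ 2 / 2))) := by gcongr
    _ = _ := by ring

lemma exp_quarter_integrable :
    Integrable (fun x : ℝ => Real.exp (x ^ 2 / 4)) (gaussianReal 0 1) := by
  rw [gaussianReal_of_var_ne_zero _ (by norm_num)]
  rw [integrable_withDensity_iff (measurable_gaussianPDF 0 1)
    (Filter.Eventually.of_forall fun x => gaussianPDF_lt_top)]
  have h := (integrable_exp_neg_mul_sq (b := 1/4) (by norm_num)).const_mul (Real.sqrt (2 * Real.pi))⁻¹
  refine h.congr (Filter.Eventually.of_forall fun x => ?_)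
  simp only
  rw [toReal_gaussianPDF, pdf_eq, mul_comm (Real.exp (x ^ 2 / 4)), mul_assoc, ← Real.exp_add]
  ring_nf

lemma exp_quarter_integral : ∫ x : ℝ, Real.exp (x ^ 2 / 4) ∂(gaussianReal 0 1) ≤ 1.5 := by
  rw [integral_gaussianReal_eq_integral_smul (by norm_num)]
  have h1 : (fun x : ℝ => gaussianPDFReal 0 1 x • Real.exp (x ^ 2 / 4)) =
      fun x => (Real.sqrt (2 * Real.pi))⁻¹ * Real.exp (-(1/4) * x ^ 2) := by
    funext x
    rw [pdf_eq, smul_eq_mul, mul_assoc, ← Real.exp_add]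
    ring_nf
  rw [h1, integral_const_mul, integral_gaussian]
  have hp := Real.pi_pos
  rw [inv_mul_le_iff₀ (by positivity)]
  apply Real.sqrt_le_iff.2
  constructor
  · positivity
  · rw [mul_pow, Real.sq_sqrt (by positivity)]; nlinarith

lemma exp_bound (y : ℝ) (hy : 0 ≤ y) : Real.exp y ≤ 1 + y + y ^ 2 * Real.exp y := by
  have h1 : Real.exp y - 1 ≤ y * Real.exp y := by
    have := Real.add_one_le_exp (-y)
    have h2 : Real.exp (-y) * Real.exp y = 1 := by rw [← Real.exp_add]; simp
    nlinarith [Real.exp_pos y]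
  nlinarith

lemma exp_trF_bound (τ l x : ℝ) (hl : 0 ≤ l) (hl' : l ≤ 1 / 8) :
    Real.exp (l * trF τ x) ≤ 1 + l * trF τ x + 128 * l ^ 2 * Real.exp (x ^ 2 / 4) := by
  have h0 := trF_nonneg τ x
  have h1 := trF_le τ x
  refine (exp_bound _ (mul_nonneg hl h0)).trans ?_
  have h2 : (x ^ 2) ^ 2 ≤ 128 * Real.exp (x ^ 2 / 8) := by
    have := Real.quadratic_le_exp_of_nonneg (x := x ^ 2 / 8) (by positivity)
    nlinarith [sq_nonneg x]
  have h3 : l * trF τ x ≤ x ^ 2 / 8 := by nlinarith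
  have h4 : (l * trF τ x) ^ 2 ≤ l ^ 2 * (128 * Real.exp (x ^ 2 / 8)) := by
    rw [mul_pow]
    have : trF τ x ^ 2 ≤ (x ^ 2) ^ 2 := by gcongr
    gcongr
    linarith
  have h5 : Real.exp (x ^ 2 / 4) = Real.exp (x ^ 2 / 8) * Real.exp (x ^ 2 / 8) := by
    rw [← Real.exp_add]; ring_nf
  have h6 : (l * trF τ x) ^ 2 * Real.exp (l * trF τ x) ≤
      l ^ 2 * (128 * Real.exp (x ^ 2 / 8)) * Real.exp (x ^ 2 / 8) := by gcongr
  rw [h5]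
  linarith

lemma trF_integrable (τ : ℝ) : Integrable (trF τ) (gaussianReal 0 1) := by
  refine (exp_quarter_integrable.const_mul 4).mono' (measurable_trF τ).aestronglyMeasurable ?_
  refine Filter.Eventually.of_forall fun x => ?_
  rw [Real.norm_eq_abs, abs_of_nonneg (trF_nonneg _ _)]
  have := Real.add_one_le_exp (x ^ 2 / 4)
  linarith [trF_le τ x]

lemma exp_trF_integrable (τ l : ℝ) (hl : 0 ≤ l) (hl' : l ≤ 1 / 8) :
    Integrable (fun x => Real.exp (l * trF τ x)) (gaussianReal 0 1) := by
  refine exp_quarter_integrable.mono'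
    ((measurable_trF τ).const_mul l).exp.aestronglyMeasurable ?_
  refine Filter.Eventually.of_forall fun x => ?_
  rw [Real.norm_eq_abs, Real.abs_exp]
  apply Real.exp_le_exp.2
  nlinarith [trF_le τ x, trF_nonneg τ x, sq_nonneg x]

lemma mgf_trF (τ l : ℝ) (hl : 0 ≤ l) (hl' : l ≤ 1 / 8) :
    ∫ x, Real.exp (l * trF τ x) ∂(gaussianReal 0 1) ≤
      Real.exp (l * (∫ x, trF τ x ∂(gaussianReal 0 1)) + 200 * l ^ 2) := by
  have h1 : ∫ x, Real.exp (l * trF τ x) ∂(gaussianReal 0 1) ≤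
      ∫ x, (1 + l * trF τ x + 128 * l ^ 2 * Real.exp (x ^ 2 / 4)) ∂(gaussianReal 0 1) := by
    apply integral_mono (exp_trF_integrable τ l hl hl')
    · exact ((integrable_const _).add ((trF_integrable τ).const_mul l)).add
        (exp_quarter_integrable.const_mul _)
    · intro x; exact exp_trF_bound τ l x hl hl'
  have hi : Integrable (fun x => 1 + l * trF τ x) (gaussianReal 0 1) :=
    (integrable_const _).add ((trF_integrable τ).const_mul l)
  rw [integral_add hi (exp_quarter_integrable.const_mul _), integral_add (integrable_const _)
        ((trF_integrable τ).const_mul l), integral_const_mul, integral_const_mul] at h1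
  simp only [integral_const, probReal_univ, smul_eq_mul, mul_one] at h1
  have h2 := exp_quarter_integral
  have h3 := Real.add_one_le_exp (l * (∫ x, trF τ x ∂(gaussianReal 0 1)) + 200 * l ^ 2)
  nlinarith [sq_nonneg l]

instance (n : ℕ) : IsProbabilityMeasure (stdGaussianVec n) := by
  unfold stdGaussianVec; infer_instance

instance (m n : ℕ) : IsProbabilityMeasure (sampleMeasure m n) := by
  unfold sampleMeasure; infer_instance

lemma measurable_dotp {n : ℕ} (u : Fin n → ℝ) : Measurable (fun a : Fin n → ℝ => dotp a u) := by
  unfold dotp; fun_prop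

lemma map_dotp {n : ℕ} (u : Fin n → ℝ) (hu : ∑ i, (u i) ^ 2 = 1) :
    (stdGaussianVec n).map (fun a => dotp a u) = gaussianReal 0 1 := by
  have : IsProbabilityMeasure ((stdGaussianVec n).map (fun a => dotp a u)) :=
    Measure.isProbabilityMeasure_map (measurable_dotp u).aemeasurable
  apply Measure.ext_of_charFun
  funext t
  rw [charFun_apply_real, integral_map (measurable_dotp u).aemeasurable (by fun_prop)]
  have h1 : ∀ a : Fin n → ℝ, Complex.exp (t * (dotp a u : ℝ) * Complex.I) =
      ∏ i, (fun x : ℝ => Complex.exp (((t * u i : ℝ) : ℂ) * x * Complex.I)) (a i) := by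
    intro a
    simp only [← Complex.exp_sum, dotp]
    congr 1
    push_cast
    rw [Finset.mul_sum, Finset.sum_mul]
    exact Finset.sum_congr rfl fun i _ => by ring
  simp_rw [h1]
  unfold stdGaussianVec
  rw [integral_fintype_prod_eq_prod (𝕜 := ℂ) (f := fun i (x : ℝ) => Complex.exp (((t * u i : ℝ) : ℂ) * x * Complex.I))]
  simp_rw [← charFun_apply_real, charFun_gaussianReal, ← Complex.exp_sum]
  congr 1
  have h2 : (∑ i, ((u i : ℝ) : ℂ) ^ 2) = 1 := by exact_mod_cast hu
  push_cast
  simp only [mul_zero, zero_mul, zero_sub, one_mul, mul_pow]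
  rw [Finset.sum_neg_distrib, ← Finset.sum_div, ← Finset.mul_sum, h2, mul_one]

lemma chernoff {m n : ℕ} (u : Fin n → ℝ) (hu : ∑ i, (u i) ^ 2 = 1) (τ e : ℝ) (he : 0 ≤ e)
    (he1 : e ≤ 1) :
    (sampleMeasure m n).real {a | (m : ℝ) * ((∫ x, trF τ x ∂(gaussianReal 0 1)) + e) ≤
      ∑ k, trF τ (dotp (a k) u)} ≤ Real.exp (-(m * e ^ 2 / 800)) := by
  set l := e / 400 with hl
  have hl0 : 0 ≤ l := by positivity
  have hl1 : l ≤ 1 / 8 := by rw [hl]; linarith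
  set E := ∫ x, trF τ x ∂(gaussianReal 0 1) with hE
  have hexp : ∀ a : Fin m → Fin n → ℝ, Real.exp (l * ∑ k, trF τ (dotp (a k) u)) =
      ∏ k, (fun b : Fin n → ℝ => Real.exp (l * trF τ (dotp b u))) (a k) := by
    intro a
    rw [Finset.mul_sum, Real.exp_sum]
  have hi1 : Integrable (fun b : Fin n → ℝ => Real.exp (l * trF τ (dotp b u))) (stdGaussianVec n) := by
    have := exp_trF_integrable τ l hl0 hl1
    rw [← map_dotp u hu] at this
    exact this.comp_measurable (measurable_dotp u)
  have hv1 : ∫ b : Fin n → ℝ, Real.exp (l * trF τ (dotp b u)) ∂(stdGaussianVec n) ≤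
      Real.exp (l * E + 200 * l ^ 2) := by
    have := mgf_trF τ l hl0 hl1
    rw [← hE] at this
    rw [← map_dotp u hu, integral_map (measurable_dotp u).aemeasurable] at this
    · exact this
    · exact ((measurable_trF τ).const_mul l).exp.aestronglyMeasurable
  have hi : Integrable (fun a : Fin m → Fin n → ℝ => Real.exp (l * ∑ k, trF τ (dotp (a k) u)))
      (sampleMeasure m n) := by
    simp_rw [hexp]
    exact Integrable.fintype_prod (fun _ => hi1)
  refine (measure_ge_le_exp_mul_mgf _ hl0 hi).trans ?_
  have hm : mgf (fun a : Fin m → Fin n → ℝ => ∑ k, trF τ (dotp (a k) u)) (sampleMeasure m n) l ≤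
      Real.exp (m * (l * E + 200 * l ^ 2)) := by
    unfold mgf
    simp_rw [hexp]
    unfold sampleMeasure
    rw [integral_fintype_prod_eq_prod (𝕜 := ℝ) (f := fun _ (b : Fin n → ℝ) => Real.exp (l * trF τ (dotp b u)))]
    rw [Finset.prod_const, Finset.card_univ, Fintype.card_fin, Real.exp_nat_mul]
    exact pow_le_pow_left₀ (integral_nonneg fun _ => by positivity) hv1 m
  calc _ ≤ Real.exp (-l * (m * (E + e))) * Real.exp (m * (l * E + 200 * l ^ 2)) := by gcongr
    _ = _ := by
      rw [← Real.exp_add, hl]; congr 1; ring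

lemma card_sep {E : Type*} [NormedAddCommGroup E] [NormedSpace ℝ E] [FiniteDimensional ℝ E]
    (s : Finset E) (hs : ∀ c ∈ s, ‖c‖ ≤ 1)
    (h : ∀ c ∈ s, ∀ d ∈ s, c ≠ d → 1 / 1000 ≤ ‖c - d‖) :
    s.card ≤ 2001 ^ Module.finrank ℝ E := by
  borelize E
  let μ : Measure E := Measure.addHaar
  let δ : ℝ := (1 : ℝ) / 2000
  let ρ : ℝ := (2001 : ℝ) / 2000
  have ρpos : 0 < ρ := by norm_num [ρ]
  have δpos : 0 < δ := by norm_num [δ]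
  set A := ⋃ c ∈ s, Metric.ball (c : E) δ with hA
  have D : Set.Pairwise (s : Set E) (Function.onFun Disjoint fun c => Metric.ball (c : E) δ) := by
    rintro c hc d hd hcd
    apply Metric.ball_disjoint_ball
    rw [dist_eq_norm]
    have := h c hc d hd hcd
    have h2 : δ + δ = 1 / 1000 := by norm_num [δ]
    exact h2.le.trans this
  have A_subset : A ⊆ Metric.ball (0 : E) ρ := by
    refine Set.iUnion₂_subset fun x hx => ?_
    apply Metric.ball_subset_ball'
    rw [dist_zero_right]
    have := hs x hx
    have h2 : ρ = δ + 1 := by norm_num [δ, ρ]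
    linarith
  have I :
    (s.card : ENNReal) * ENNReal.ofReal (δ ^ Module.finrank ℝ E) * μ (Metric.ball 0 1) ≤
      ENNReal.ofReal (ρ ^ Module.finrank ℝ E) * μ (Metric.ball 0 1) :=
    calc
      (s.card : ENNReal) * ENNReal.ofReal (δ ^ Module.finrank ℝ E) * μ (Metric.ball 0 1) = μ A := by
        rw [hA, measure_biUnion_finset D fun c _ => measurableSet_ball]
        simp only [μ.addHaar_ball_of_pos _ δpos]
        simp only [Finset.sum_const, nsmul_eq_mul, mul_assoc]
      _ ≤ μ (Metric.ball (0 : E) ρ) := measure_mono A_subset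
      _ = ENNReal.ofReal (ρ ^ Module.finrank ℝ E) * μ (Metric.ball 0 1) := by
        simp only [μ.addHaar_ball_of_pos _ ρpos]
  have J : (s.card : ENNReal) * ENNReal.ofReal (δ ^ Module.finrank ℝ E) ≤
      ENNReal.ofReal (ρ ^ Module.finrank ℝ E) :=
    (ENNReal.mul_le_mul_iff_left (Metric.measure_ball_pos _ _ zero_lt_one).ne' measure_ball_lt_top.ne).1 I
  have K : (s.card : ℝ) ≤ (2001 : ℝ) ^ Module.finrank ℝ E := by
    have := ENNReal.toReal_le_of_le_ofReal (pow_nonneg ρpos.le _) J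
    rw [ENNReal.toReal_mul, ENNReal.toReal_natCast, ENNReal.toReal_ofReal (by positivity)] at this
    have h2 : ρ = 2001 * δ := by norm_num [δ, ρ]
    rw [h2, mul_pow] at this
    exact le_of_mul_le_mul_right this (by positivity)
  exact mod_cast K

/-- A `1/1000`-net of the unit sphere. -/
lemma exists_net (n : ℕ) : ∃ s : Finset (EuclideanSpace ℝ (Fin n)), s.card ≤ 2001 ^ n ∧
    (∀ c ∈ s, ‖c‖ = 1) ∧ ∀ u : EuclideanSpace ℝ (Fin n), ‖u‖ = 1 → ∃ c ∈ s, ‖u - c‖ ≤ 1 / 1000 := by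
  let P : Finset (EuclideanSpace ℝ (Fin n)) → Prop := fun s => (∀ c ∈ s, ‖c‖ = 1) ∧
    ∀ c ∈ s, ∀ d ∈ s, c ≠ d → 1 / 1000 ≤ ‖c - d‖
  have hb : ∀ s, P s → s.card ≤ 2001 ^ n := by
    intro s hs
    have := card_sep s (fun c hc => (hs.1 c hc).le) hs.2
    simpa using this
  let T : Set ℕ := {k | ∃ s, P s ∧ s.card = k}
  have hT : T.Nonempty := ⟨0, ∅, by simp [P], by simp⟩
  have hTb : BddAbove T := ⟨2001 ^ n, by rintro k ⟨s, hs, rfl⟩; exact hb s hs⟩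
  obtain ⟨s, hs, hk⟩ := Nat.sSup_mem hT hTb
  refine ⟨s, hb s hs, hs.1, ?_⟩
  intro u hu
  by_contra! hc
  have hus : u ∉ s := by
    intro h
    have := hc u h
    norm_num at this
  have hP : P (insert u s) := by
    constructor
    · intro c h
      rcases Finset.mem_insert.1 h with rfl | h
      · exact hu
      · exact hs.1 c h
    · intro c hc1 d hd1 hne
      rcases Finset.mem_insert.1 hc1 with h1 | h1 <;> rcases Finset.mem_insert.1 hd1 with h2 | h2
      · exact absurd (h1.trans h2.symm) hne
      · rw [h1]; exact (hc d h2).le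
      · rw [norm_sub_rev, h2]; exact (hc c h1).le
      · exact hs.2 c h1 d h2 hne
  have : (insert u s).card ≤ sSup T := le_csSup hTb ⟨_, hP, rfl⟩
  rw [Finset.card_insert_of_notMem hus] at this
  omega

lemma trF_split (γ t t0 : ℝ) (hγ : 0 < γ) :
    trF γ t ≤ (1 / 0.9801) * trF (0.99 * γ) t0 + 10000 * trF (0.01 * γ) (t - t0) := by
  have h1 := trF_nonneg (0.99 * γ) t0
  have h2 := trF_nonneg (0.01 * γ) (t - t0)
  by_cases h : γ < |t|
  · have e1 : trF γ t = t ^ 2 := by simp [trF, h]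
    rw [e1]
    by_cases hd : |t - t0| ≤ 0.01 * |t|
    · have h3 : |t| ≤ |t0| + |t - t0| := by
        have := abs_add_le t0 (t - t0)
        simpa using this
      have h4 : 0.99 * |t| ≤ |t0| := by linarith
      have e2 : trF (0.99 * γ) t0 = t0 ^ 2 := by
        have : 0.99 * γ < |t0| := by linarith
        simp only [trF, this, if_true]
      rw [e2]
      have h5 : (0.99 * |t|) ^ 2 ≤ |t0| ^ 2 := by gcongr
      rw [mul_pow, sq_abs, sq_abs] at h5
      norm_num at h5 ⊢
      linarith
    · push Not at hd
      have e2 : trF (0.01 * γ) (t - t0) = (t - t0) ^ 2 := by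
        have : 0.01 * γ < |t - t0| := by linarith
        simp only [trF, this, if_true]
      rw [e2]
      have h5 : (0.01 * |t|) ^ 2 ≤ |t - t0| ^ 2 := by gcongr
      rw [mul_pow, sq_abs, sq_abs] at h5
      norm_num at h5 h1 ⊢
      linarith
  · have e1 : trF γ t = 0 := by simp [trF, h]
    rw [e1]; positivity

lemma trF_scale (γ r t : ℝ) (hγ : 0 < γ) (hr : 0 ≤ r) (hr1 : r ≤ 1 / 1000) :
    trF (0.01 * γ) (r * t) ≤ 1 / 1000000 * trF γ t := by
  by_cases h : 0.01 * γ < |r * t|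
  · have e1 : trF (0.01 * γ) (r * t) = (r * t) ^ 2 := by simp only [trF, h, if_true]
    rw [abs_mul, abs_of_nonneg hr] at h
    have h2 : r * |t| ≤ 1 / 1000 * |t| := by gcongr
    have h3 : γ < |t| := by
      norm_num at h h2
      linarith
    have e2 : trF γ t = t ^ 2 := by simp only [trF, h3, if_true]
    rw [e1, e2, mul_pow]
    have : r ^ 2 ≤ (1 / 1000) ^ 2 := by gcongr
    norm_num at this ⊢
    gcongr
  · have e1 : trF (0.01 * γ) (r * t) = 0 := by simp only [trF, h, if_false]
    rw [e1]
    have := trF_nonneg γ t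
    positivity

lemma euclid_sum {n : ℕ} (u : EuclideanSpace ℝ (Fin n)) : ∑ i, (u i) ^ 2 = ‖u‖ ^ 2 := by
  rw [EuclideanSpace.norm_sq_eq]; simp

lemma dotp_smul {n : ℕ} (a : Fin n → ℝ) (r : ℝ) (u : Fin n → ℝ) :
    dotp a (fun i => r * u i) = r * dotp a u := by
  unfold dotp; rw [Finset.mul_sum]; exact Finset.sum_congr rfl fun i _ => by ring

lemma det_bound {m n : ℕ} (a : Fin m → Fin n → ℝ) (γ B : ℝ) (hγ : 0 < γ)
    (s : Finset (EuclideanSpace ℝ (Fin n)))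
    (hs : ∀ u : EuclideanSpace ℝ (Fin n), ‖u‖ = 1 → ∃ c ∈ s, ‖u - c‖ ≤ 1 / 1000)
    (hB : ∀ c ∈ s, ∑ k, trF (0.99 * γ) (dotp (a k) (fun i => c i)) ≤ B)
    (u : EuclideanSpace ℝ (Fin n)) (hu : ‖u‖ = 1) :
    ∑ k, trF γ (dotp (a k) (fun i => u i)) ≤ 1.031 * B := by
  let S : EuclideanSpace ℝ (Fin n) → ℝ := fun u => ∑ k, trF γ (dotp (a k) (fun i => u i))
  let T : Set ℝ := {x | ∃ u, ‖u‖ = 1 ∧ S u = x}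
  have hTb : BddAbove T := by
    refine ⟨∑ k, ∑ i, (a k i) ^ 2, ?_⟩
    rintro x ⟨u, hu, rfl⟩
    refine Finset.sum_le_sum fun k _ => (trF_le _ _).trans ?_
    have := Finset.sum_mul_sq_le_sq_mul_sq Finset.univ (a k) (fun i => u i)
    rw [euclid_sum, hu] at this
    simpa [dotp] using this
  have hTn : T.Nonempty := ⟨S u, u, hu, rfl⟩
  have hle : ∀ w : EuclideanSpace ℝ (Fin n), ‖w‖ = 1 → S w ≤ sSup T :=
    fun w hw => le_csSup hTb ⟨w, hw, rfl⟩
  have hS0 : 0 ≤ S u := Finset.sum_nonneg fun k _ => trF_nonneg _ _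
  have hM0 : 0 ≤ sSup T := hS0.trans (hle u hu)
  have hstep : ∀ w : EuclideanSpace ℝ (Fin n), ‖w‖ = 1 → S w ≤ (1 / 0.9801) * B + 0.01 * sSup T := by
    intro w hw
    obtain ⟨c, hc, hwc⟩ := hs w hw
    have hd : ∀ k, dotp (a k) (fun i => w i) - dotp (a k) (fun i => c i) =
        dotp (a k) (fun i => (w - c) i) := by
      intro k
      unfold dotp
      rw [← Finset.sum_sub_distrib]
      exact Finset.sum_congr rfl fun i _ => by simp; ring
    have h1 : S w ≤ (1 / 0.9801) * (∑ k, trF (0.99 * γ) (dotp (a k) (fun i => c i))) +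
        10000 * ∑ k, trF (0.01 * γ) (dotp (a k) (fun i => (w - c) i)) := by
      rw [Finset.mul_sum, Finset.mul_sum, ← Finset.sum_add_distrib]
      refine Finset.sum_le_sum fun k _ => ?_
      rw [← hd k]
      exact trF_split _ _ _ hγ
    have h2 : ∑ k, trF (0.01 * γ) (dotp (a k) (fun i => (w - c) i)) ≤ 1 / 1000000 * sSup T := by
      by_cases h0 : w - c = 0
      · rw [h0]
        have : ∀ k, trF (0.01 * γ) (dotp (a k) (fun i => (0 : EuclideanSpace ℝ (Fin n)) i)) = 0 := by
          intro k; simp [dotp, trF]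
        rw [Finset.sum_eq_zero fun k _ => this k]
        positivity
      · have hn : ‖w - c‖ ≠ 0 := norm_ne_zero_iff.2 h0
        let y : EuclideanSpace ℝ (Fin n) := ‖w - c‖⁻¹ • (w - c)
        have hy : ‖y‖ = 1 := by
          rw [norm_smul, norm_inv, norm_norm, inv_mul_cancel₀ hn]
        have hyi : ∀ i, (w - c) i = ‖w - c‖ * y i := by
          intro i
          simp only [y, PiLp.smul_apply, smul_eq_mul]
          rw [mul_inv_cancel_left₀ hn]
        calc _ = ∑ k, trF (0.01 * γ) (‖w - c‖ * dotp (a k) (fun i => y i)) := by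
              refine Finset.sum_congr rfl fun k _ => ?_
              rw [← dotp_smul]; simp_rw [← hyi]
          _ ≤ ∑ k, 1 / 1000000 * trF γ (dotp (a k) (fun i => y i)) :=
              Finset.sum_le_sum fun k _ => trF_scale _ _ _ hγ (norm_nonneg _) hwc
          _ = 1 / 1000000 * S y := by rw [← Finset.mul_sum]
          _ ≤ _ := by gcongr; exact hle y hy
    have h3 := hB c hc
    norm_num at h1 h2 h3 ⊢
    linarith
  have hM : sSup T ≤ (1 / 0.9801) * B + 0.01 * sSup T := by
    apply csSup_le hTn
    rintro x ⟨w, hw, rfl⟩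
    exact hstep w hw
  have hB0 : 0 ≤ B := by norm_num at hM; linarith
  have := hle u hu
  change S u ≤ _
  norm_num at hM ⊢
  linarith

lemma exists_unit {n : ℕ} (hn : 0 < n) (v : Fin n → ℝ) :
    ∃ u : EuclideanSpace ℝ (Fin n), ‖u‖ = 1 ∧ v = fun i => vecNorm v * u i := by
  have hv : vecNorm v = ‖(WithLp.toLp 2 v : EuclideanSpace ℝ (Fin n))‖ := by
    rw [EuclideanSpace.norm_eq]; simp [vecNorm]
  by_cases h : v = 0
  · refine ⟨EuclideanSpace.single ⟨0, hn⟩ 1, by simp, ?_⟩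
    funext i
    rw [h]; simp [vecNorm]
  · have hne : ‖(WithLp.toLp 2 v : EuclideanSpace ℝ (Fin n))‖ ≠ 0 := by
      rw [norm_ne_zero_iff]
      intro h'
      apply h
      funext i
      exact congrArg (fun x : EuclideanSpace ℝ (Fin n) => x i) h'
    refine ⟨‖(WithLp.toLp 2 v : EuclideanSpace ℝ (Fin n))‖⁻¹ • WithLp.toLp 2 v, ?_, ?_⟩
    · rw [norm_smul, norm_inv, norm_norm, inv_mul_cancel₀ hne]
    · funext i
      rw [hv]
      simp only [PiLp.smul_apply, smul_eq_mul]
      rw [mul_inv_cancel_left₀ hne]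

lemma vecNorm_nonneg {n : ℕ} (v : Fin n → ℝ) : 0 ≤ vecNorm v := Real.sqrt_nonneg _

lemma vecNorm_pos {n : ℕ} (v : Fin n → ℝ) (hv : v ≠ 0) : 0 < vecNorm v := by
  obtain ⟨i, hi⟩ := Function.ne_iff.1 hv
  apply Real.sqrt_pos.2
  exact Finset.sum_pos' (fun _ _ => by positivity) ⟨i, Finset.mem_univ _, by
    have : v i ≠ 0 := hi
    positivity⟩

lemma prod_trunc (γ x y t : ℝ) (hγ : 0 < γ) :
    |if γ < |t| then x * y else 0| ≤ trF γ x / 2 + trF γ y / 2 + trF γ t := by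
  have key : ∀ x, γ < |t| → x ^ 2 ≤ trF γ x + trF γ t := by
    intro x ht
    have e : trF γ t = t ^ 2 := by simp only [trF, ht, if_true]
    by_cases hx : γ < |x|
    · have e : trF γ x = x ^ 2 := by simp only [trF, hx, if_true]
      rw [e]; linarith [trF_nonneg γ t]
    · rw [e]
      have : |x| ≤ |t| := by linarith
      have := sq_le_sq.2 this
      linarith [trF_nonneg γ x]
  have hx := trF_nonneg γ x
  have hy := trF_nonneg γ y
  have ht := trF_nonneg γ t
  split_ifs with h
  · have h1 := key x h
    have h2 := key y h
    rw [abs_le]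
    constructor <;> nlinarith [sq_nonneg (x + y), sq_nonneg (x - y)]
  · simp only [abs_zero]; positivity

lemma quad_form {m n : ℕ} (a : Fin m → Fin n → ℝ) (p : Fin m → Prop) (v w : Fin n → ℝ) :
    ∑ i, ∑ j, v i * ((1 / (m : ℝ)) • ∑ k, if p k then
      vecMulVec (a k) (a k) else (0 : Matrix (Fin n) (Fin n) ℝ)) i j * w j =
    (1 / (m : ℝ)) * ∑ k, if p k then dotp (a k) v * dotp (a k) w else 0 := by
  have h : ∀ i j, v i * ((1 / (m : ℝ)) • ∑ k, if p k then
      vecMulVec (a k) (a k) else (0 : Matrix (Fin n) (Fin n) ℝ)) i j * w j =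
      ∑ k, (1 / (m : ℝ)) * (if p k then (a k i * v i) * (a k j * w j) else 0) := by
    intro i j
    rw [Matrix.smul_apply, Matrix.sum_apply, smul_eq_mul, Finset.mul_sum, Finset.mul_sum,
      Finset.sum_mul]
    refine Finset.sum_congr rfl fun k _ => ?_
    split_ifs
    · rw [vecMulVec_apply]; ring
    · simp
  simp_rw [h]
  calc _ = ∑ i, ∑ k, ∑ j, (1 / (m : ℝ)) * (if p k then (a k i * v i) * (a k j * w j) else 0) :=
        Finset.sum_congr rfl fun i _ => Finset.sum_comm
    _ = ∑ k, ∑ i, ∑ j, (1 / (m : ℝ)) * (if p k then (a k i * v i) * (a k j * w j) else 0) :=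
        Finset.sum_comm
    _ = _ := by
      rw [Finset.mul_sum]
      refine Finset.sum_congr rfl fun k _ => ?_
      split_ifs
      · unfold dotp
        rw [Finset.sum_mul_sum, Finset.mul_sum]
        exact Finset.sum_congr rfl fun i _ => by rw [Finset.mul_sum]
      · simp

lemma bilinear_bound {m n : ℕ} (hn : 0 < n) (hm : 0 < m) (a : Fin m → Fin n → ℝ) (γ K : ℝ)
    (hγ : 0 < γ)
    (hK : ∀ u : EuclideanSpace ℝ (Fin n), ‖u‖ = 1 →
      ∑ k, trF γ (dotp (a k) (fun i => u i)) ≤ m * (K / 2))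
    (z : Fin n → ℝ) (hz : z ≠ 0) (v w : Fin n → ℝ) :
    |∑ i, ∑ j, v i * ((1 / (m : ℝ)) • ∑ k, if γ * vecNorm z < |dotp (a k) z| then
      vecMulVec (a k) (a k) else (0 : Matrix (Fin n) (Fin n) ℝ)) i j * w j| ≤
    K * vecNorm v * vecNorm w := by
  rw [quad_form]
  obtain ⟨v', hv1, hv⟩ := exists_unit hn v
  obtain ⟨w', hw1, hw⟩ := exists_unit hn w
  obtain ⟨z', hz1, hzz⟩ := exists_unit hn z
  have ev : ∀ k, dotp (a k) v = vecNorm v * dotp (a k) (fun i => v' i) := fun k => by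
    rw [← dotp_smul, ← hv]
  have ew : ∀ k, dotp (a k) w = vecNorm w * dotp (a k) (fun i => w' i) := fun k => by
    rw [← dotp_smul, ← hw]
  have ez : ∀ k, dotp (a k) z = vecNorm z * dotp (a k) (fun i => z' i) := fun k => by
    rw [← dotp_smul, ← hzz]
  have hzp := vecNorm_pos z hz
  have hvp := vecNorm_nonneg v
  have hwp := vecNorm_nonneg w
  have hiff : ∀ k, γ * vecNorm z < |dotp (a k) z| ↔ γ < |dotp (a k) (fun i => z' i)| := by
    intro k
    rw [ez, abs_mul, abs_of_pos hzp, mul_comm γ]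
    exact mul_lt_mul_iff_right₀ hzp
  have e : ∑ k, (if γ * vecNorm z < |dotp (a k) z| then dotp (a k) v * dotp (a k) w else 0) =
      vecNorm v * vecNorm w * ∑ k, (if γ < |dotp (a k) (fun i => z' i)| then
        dotp (a k) (fun i => v' i) * dotp (a k) (fun i => w' i) else 0) := by
    rw [Finset.mul_sum]
    refine Finset.sum_congr rfl fun k _ => ?_
    simp only [hiff k]
    split_ifs
    · rw [ev, ew]; ring
    · simp
  rw [e, abs_mul, abs_mul, abs_mul, abs_of_nonneg hvp, abs_of_nonneg hwp]
  have hb : |∑ k, (if γ < |dotp (a k) (fun i => z' i)| then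
        dotp (a k) (fun i => v' i) * dotp (a k) (fun i => w' i) else 0)| ≤ m * K := by
    refine (Finset.abs_sum_le_sum_abs _ _).trans ?_
    refine (Finset.sum_le_sum fun k _ => prod_trunc γ _ _ _ hγ).trans ?_
    rw [Finset.sum_add_distrib, Finset.sum_add_distrib, ← Finset.sum_div, ← Finset.sum_div]
    have h1 := hK v' hv1
    have h2 := hK w' hw1
    have h3 := hK z' hz1
    linarith
  have hmp : (0 : ℝ) < m := by exact_mod_cast hm
  rw [abs_of_pos (by positivity : (0 : ℝ) < 1 / m)]
  calc _ ≤ 1 / (m : ℝ) * (vecNorm v * vecNorm w * (m * K)) := by gcongr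
    _ = _ := by field_simp

lemma numeric (γ ε E : ℝ) (hγ : 1 ≤ γ) (hε : 0 < ε)
    (hE : E ≤ 0.8 * ((0.99 * γ + 1 / (0.99 * γ)) * Real.exp (-(0.99 * γ) ^ 2 / 2))) :
    1.031 * (E + ε / 3) ≤ (5 * γ * Real.exp (-(0.49 * γ ^ 2)) + ε) / 2 := by
  have h1 : Real.exp (-(0.99 * γ) ^ 2 / 2) ≤ Real.exp (-(0.49 * γ ^ 2)) := by
    apply Real.exp_le_exp.2
    nlinarith
  have h2 : 1 / (0.99 * γ) ≤ 1.02 * γ := by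
    rw [div_le_iff₀ (by positivity)]
    nlinarith
  have h3 : (0.99 * γ + 1 / (0.99 * γ)) * Real.exp (-(0.99 * γ) ^ 2 / 2) ≤
      (0.99 * γ + 1.02 * γ) * Real.exp (-(0.49 * γ ^ 2)) := by gcongr
  have h4 : 0 < γ * Real.exp (-(0.49 * γ ^ 2)) := by positivity
  norm_num at hE h3 h4 ⊢
  linarith

lemma union_numeric (n : ℕ) (x : ℝ) (hx : 115200 * (n : ℝ) ≤ x) :
    (2001 : ℝ) ^ n * Real.exp (-(x / 7200)) ≤ Real.exp (-(x / 14400)) := by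
  have h1 : (2001 : ℝ) ≤ Real.exp 8 := by
    have h := Real.exp_one_gt_d9
    have e : Real.exp 8 = Real.exp 1 ^ 8 := by rw [← Real.exp_nat_mul]; norm_num
    rw [e]
    calc (2001 : ℝ) ≤ 2.7 ^ 8 := by norm_num
      _ ≤ _ := by gcongr; linarith
  calc (2001 : ℝ) ^ n * Real.exp (-(x / 7200)) ≤ Real.exp 8 ^ n * Real.exp (-(x / 7200)) := by gcongr
    _ = Real.exp (n * 8 + -(x / 7200)) := by rw [Real.exp_add, Real.exp_nat_mul]
    _ ≤ _ := by apply Real.exp_le_exp.2; linarith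

/-- Uniform spectral norm bound for the truncated empirical covariance
`(1/m)∑ₖ aₖaₖᵀ·1{|aₖᵀz| > γ‖z‖}`: its spectral norm (expressed through the bilinear
form against arbitrary vectors `v, w`) is at most `5γe^{−0.49γ²} + ε`, uniformly over
all nonzero `z`, with probability at least `1 − e^{−cmε²}`, provided
`m ≥ Cε⁻²log(ε⁻¹)n`. -/
theorem truncated_covariance_spectral_bound :
    ∃ c C εbar : ℝ, 0 < c ∧ 0 < C ∧ εbar ∈ Set.Ioo (0:ℝ) 1 ∧
      ∀ γ : ℝ, 1 ≤ γ → ∀ ε : ℝ, 0 < ε → ε < εbar →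
      ∀ n m : ℕ, 0 < n → 0 < m → C * ε⁻¹^2 * Real.log ε⁻¹ * (n : ℝ) ≤ (m : ℝ) →
      sampleMeasure m n {a : Fin m → Fin n → ℝ |
        ∀ z : Fin n → ℝ, z ≠ 0 → ∀ v w : Fin n → ℝ,
          |∑ i, ∑ j, v i *
              ((1 / (m : ℝ)) • ∑ k, if γ * vecNorm z < |dotp (a k) z| then
                  vecMulVec (a k) (a k) else (0 : Matrix (Fin n) (Fin n) ℝ)) i j
                * w j|
            ≤ (5 * γ * Real.exp (-(0.49 * γ^2)) + ε) * vecNorm v * vecNorm w}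
        ≥ ENNReal.ofReal (1 - Real.exp (-(c * (m : ℝ) * ε^2))) := by
  refine ⟨1 / 14400, 115200, 1 / 4, by norm_num, by norm_num, by norm_num, ?_⟩
  intro γ hγ ε hε hε4 n m hn hm hmn
  obtain ⟨s, hcard, hs1, hs⟩ := exists_net n
  set E := ∫ x, trF (0.99 * γ) x ∂(gaussianReal 0 1) with hE
  have hEb := expect_trF (0.99 * γ) (by positivity)
  have hmp : (0 : ℝ) < m := by exact_mod_cast hm
  let bad : EuclideanSpace ℝ (Fin n) → Set (Fin m → Fin n → ℝ) := fun c =>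
    {a | (m : ℝ) * (E + ε / 3) ≤ ∑ k, trF (0.99 * γ) (dotp (a k) (fun i => c i))}
  have hbadm : MeasurableSet (⋃ c ∈ s, bad c) := by
    refine Finset.measurableSet_biUnion s fun c _ => ?_
    refine measurableSet_le measurable_const ?_
    refine Finset.measurable_sum _ fun k _ => ?_
    exact (measurable_trF _).comp ((measurable_dotp _).comp (measurable_pi_apply k))
  have hlog : 1 ≤ Real.log ε⁻¹ := by
    rw [Real.le_log_iff_exp_le (by positivity)]
    have h4 : (4 : ℝ) ≤ ε⁻¹ := by
      rw [le_inv_comm₀ (by norm_num) hε]; norm_num at hε4 ⊢; linarith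
    linarith [Real.exp_one_lt_d9]
  have hx : 115200 * (n : ℝ) ≤ m * ε ^ 2 := by
    have h1 : 115200 * ε⁻¹ ^ 2 * (n : ℝ) ≤ m := by
      refine le_trans ?_ hmn
      have : 115200 * ε⁻¹ ^ 2 * 1 * (n : ℝ) ≤ 115200 * ε⁻¹ ^ 2 * Real.log ε⁻¹ * (n : ℝ) := by gcongr
      linarith
    have h2 : 115200 * ε⁻¹ ^ 2 * (n : ℝ) * ε ^ 2 ≤ m * ε ^ 2 := by gcongr
    have h3 : 115200 * ε⁻¹ ^ 2 * (n : ℝ) * ε ^ 2 = 115200 * n := by field_simp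
    linarith
  have hbad : (sampleMeasure m n).real (⋃ c ∈ s, bad c) ≤
      Real.exp (-(1 / 14400 * (m : ℝ) * ε ^ 2)) := by
    calc _ ≤ ∑ c ∈ s, (sampleMeasure m n).real (bad c) := measureReal_biUnion_finset_le _ _
      _ ≤ ∑ c ∈ s, Real.exp (-((m * ε ^ 2) / 7200)) := by
        refine Finset.sum_le_sum fun c hc => ?_
        have := chernoff (m := m) (fun i => c i) (by rw [euclid_sum, hs1 c hc]; norm_num)
          (0.99 * γ) (ε / 3) (by positivity) (by linarith)
        refine this.trans (le_of_eq ?_)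
        congr 1
        ring
      _ = s.card * Real.exp (-((m * ε ^ 2) / 7200)) := by rw [Finset.sum_const, nsmul_eq_mul]
      _ ≤ (2001 : ℝ) ^ n * Real.exp (-((m * ε ^ 2) / 7200)) := by
        gcongr
        exact_mod_cast hcard
      _ ≤ Real.exp (-((m * ε ^ 2) / 14400)) := union_numeric n _ hx
      _ = _ := by congr 1; ring
  have hgood : ENNReal.ofReal (1 - Real.exp (-(1 / 14400 * (m : ℝ) * ε ^ 2))) ≤
      sampleMeasure m n (⋃ c ∈ s, bad c)ᶜ := by
    rw [← ofReal_measureReal]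
    apply ENNReal.ofReal_le_ofReal
    rw [probReal_compl_eq_one_sub hbadm]
    linarith
  refine ge_iff_le.2 (hgood.trans (measure_mono ?_))
  intro a ha
  simp only [Set.mem_compl_iff, Set.mem_iUnion, not_exists] at ha
  have hB : ∀ c ∈ s, ∑ k, trF (0.99 * γ) (dotp (a k) (fun i => c i)) ≤ m * (E + ε / 3) := by
    intro c hc
    have := ha c hc
    simp only [bad, Set.mem_setOf_eq, not_le] at this
    exact this.le
  have hγ0 : 0 < γ := by linarith
  have hdet := det_bound a γ _ hγ0 s hs hB
  have hnum := numeric γ ε E hγ hε hEb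
  intro z hz v w
  refine bilinear_bound hn hm a γ _ hγ0 (fun u hu => (hdet u hu).trans ?_) z hz v w
  calc _ = m * (1.031 * (E + ε / 3)) := by ring
    _ ≤ _ := by gcongr
end

section
/- There exist absolute constants c > 0, C > 0 and ε̄ ∈ (0,1) such that for every γ ≥ 2 and every ε ∈ (0, ε̄) the following holds: if m and n are positive integers with m ≥ C·ε^{−2}·log(ε^{−1})·n, and a₁, …, a_m are independent standard Gaussian vectors in ℝⁿ, then with probability at least 1 − e^{−c·m·ε²}, the bound ‖(1/m)·Σ_{k=1}^m (a_k⊤z)²·a_k a_k⊤·1{|a_k⊤z| ≤ γ‖z‖} − (ϑ₁·zz⊤ + ϑ₂·‖z‖²·I)‖ ≤ (10γ³·e^{−0.49γ²} + (10γ²/ε)·e^{−0.49ε^{−2}} + γ⁴·ε)·‖z‖² holds simultaneously for all z ∈ ℝⁿ, where ϑ₁ = E[ξ⁴·1{|ξ| ≤ γ}] − E[ξ²·1{|ξ| ≤ γ}] and ϑ₂ = E[ξ²·1{|ξ| ≤ γ}] for ξ a standard normal random variable. -/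
open Matrix MeasureTheory ProbabilityTheory

attribute [local instance] Classical.propDecidable

namespace TFM

lemma vecNorm_eq {n : ℕ} (v : Fin n → ℝ) : vecNorm v = ‖(WithLp.toLp 2 v : EuclideanSpace ℝ (Fin n))‖ := by
  rw [EuclideanSpace.norm_eq]; simp [vecNorm]

lemma dotp_eq {n : ℕ} (v w : Fin n → ℝ) :
    dotp v w = inner ℝ (WithLp.toLp 2 w : EuclideanSpace ℝ (Fin n)) (WithLp.toLp 2 v) := by
  simp [dotp, PiLp.inner_apply]

lemma map_toLp (n : ℕ) : (stdGaussianVec n).map (WithLp.toLp 2) =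
    stdGaussian (EuclideanSpace ℝ (Fin n)) := map_pi_eq_stdGaussian

instance (n : ℕ) : IsProbabilityMeasure (stdGaussianVec n) := by
  unfold stdGaussianVec; infer_instance

instance (m n : ℕ) : IsProbabilityMeasure (sampleMeasure m n) := by
  unfold sampleMeasure; infer_instance

@[fun_prop]
lemma measurable_dotp {n : ℕ} (v : Fin n → ℝ) : Measurable (fun a : Fin n → ℝ => dotp a v) := by
  unfold dotp; fun_prop

lemma hasGaussianLaw_toLp (n : ℕ) :
    HasGaussianLaw (fun a : Fin n → ℝ => (WithLp.toLp 2 a : EuclideanSpace ℝ (Fin n)))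
      (stdGaussianVec n) where
  isGaussian_map := by
    rw [show (fun a : Fin n → ℝ => (WithLp.toLp 2 a : EuclideanSpace ℝ (Fin n))) = WithLp.toLp 2 from rfl,
      map_toLp]; infer_instance

lemma cov_dotp {n : ℕ} (v w : Fin n → ℝ) :
    cov[fun a => dotp a v, fun a => dotp a w; stdGaussianVec n] = dotp v w := by
  have h : (covarianceBilin (stdGaussian (EuclideanSpace ℝ (Fin n)))) (WithLp.toLp 2 v) (WithLp.toLp 2 w)
     = inner ℝ (WithLp.toLp 2 v : EuclideanSpace ℝ (Fin n)) (WithLp.toLp 2 w) := by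
    rw [covarianceBilin_stdGaussian]; rfl
  rw [covarianceBilin_apply_eq_cov (IsGaussian.memLp_two_id), ← map_toLp, covariance_map_fun] at h
  · rw [dotp_eq, real_inner_comm, ← h]
    congr 1
  all_goals fun_prop

lemma mean_dotp {n : ℕ} (v : Fin n → ℝ) :
    ∫ a, dotp a v ∂(stdGaussianVec n) = 0 := by
  have h := integral_strongDual_stdGaussian (E := EuclideanSpace ℝ (Fin n))
    (innerSL ℝ (WithLp.toLp 2 v))
  rw [← map_toLp, integral_map] at h
  · rw [← h]; exact integral_congr_ae (Filter.Eventually.of_forall fun a => dotp_eq a v)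
  · fun_prop
  · apply Measurable.aestronglyMeasurable; fun_prop

lemma gauss_pair {n : ℕ} (v w : Fin n → ℝ) :
    HasGaussianLaw (fun a => (dotp a v, dotp a w)) (stdGaussianVec n) := by
  have := (hasGaussianLaw_toLp n).map_fun
    ((innerSL ℝ (WithLp.toLp 2 v)).prod (innerSL ℝ (WithLp.toLp 2 w)))
  refine this.congr (Filter.Eventually.of_forall fun a => ?_)
  simp only [dotp_eq]; rfl

lemma vecNorm_sq {n : ℕ} (v : Fin n → ℝ) : vecNorm v ^ 2 = dotp v v := by
  unfold vecNorm dotp; rw [Real.sq_sqrt (by positivity)]; simp [sq]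

lemma law_dotp {n : ℕ} (v : Fin n → ℝ) (hv : vecNorm v = 1) :
    (stdGaussianVec n).map (fun a => dotp a v) = gaussianReal 0 1 := by
  have h := (gauss_pair v v).fst.map_eq_gaussianReal
  rw [h, mean_dotp, ← covariance_self (by fun_prop), cov_dotp, ← vecNorm_sq, hv]
  simp

lemma indep_dotp {n : ℕ} (v w : Fin n → ℝ) (h : dotp v w = 0) :
    IndepFun (fun a => dotp a v) (fun a => dotp a w) (stdGaussianVec n) :=
  (gauss_pair v w).indepFun_of_covariance_eq_zero (by rw [cov_dotp, h])

lemma integrable_exp_sq : Integrable (fun x : ℝ => Real.exp (x ^ 2 / 4)) (gaussianReal 0 1) := by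
  rw [gaussianReal_of_var_ne_zero _ (by simp), gaussianPDF_def]
  rw [integrable_withDensity_iff (by fun_prop) (by simp)]
  have : (fun x : ℝ => Real.exp (x ^ 2 / 4) * (ENNReal.ofReal (gaussianPDFReal 0 1 x)).toReal)
      = fun x => (√(2 * Real.pi))⁻¹ * Real.exp (-(1/4) * x ^ 2) := by
    ext x
    rw [ENNReal.toReal_ofReal (gaussianPDFReal_nonneg _ _ _), gaussianPDFReal]
    simp only [NNReal.coe_one, mul_one, sub_zero]
    rw [mul_left_comm, ← Real.exp_add]
    congr 2; ring
  rw [this]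
  exact (integrable_exp_neg_mul_sq (by norm_num)).const_mul _

/-- The absolute constant `E exp(ξ²/4)`. -/
noncomputable def K0 : ℝ := ∫ x, Real.exp (x ^ 2 / 4) ∂(gaussianReal 0 1)

lemma one_le_K0 : 1 ≤ K0 := by
  have : ∫ x : ℝ, (1:ℝ) ∂(gaussianReal 0 1) ≤ K0 := by
    apply integral_mono (integrable_const _) integrable_exp_sq
    intro x; exact Real.one_le_exp (by positivity)
  simpa using this

lemma integrable_sq : Integrable (fun x : ℝ => x ^ 2) (gaussianReal 0 1) :=
  (memLp_id_gaussianReal' 2 (by simp)).integrable_sq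

lemma integral_sq : ∫ x : ℝ, x ^ 2 ∂(gaussianReal 0 1) = 1 := by
  have := variance_eq_integral (μ := gaussianReal 0 1) (X := id) (by fun_prop)
  rw [variance_id_gaussianReal] at this
  simpa [integral_id_gaussianReal] using this.symm

lemma pow4_le (x : ℝ) : x ^ 4 ≤ 32 * Real.exp (x ^ 2 / 4) := by
  have := Real.quadratic_le_exp_of_nonneg (x := x ^ 2 / 4) (by positivity)
  nlinarith [sq_nonneg x]

lemma integrable_pow4 : Integrable (fun x : ℝ => x ^ 4) (gaussianReal 0 1) := by
  refine (integrable_exp_sq.const_mul 32).mono' (by fun_prop) (Filter.Eventually.of_forall fun x => ?_)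
  rw [Real.norm_of_nonneg (by positivity)]; exact pow4_le x

lemma integral_pow4_le : ∫ x : ℝ, x ^ 4 ∂(gaussianReal 0 1) ≤ 32 * K0 := by
  rw [K0, ← integral_const_mul]
  exact integral_mono integrable_pow4 (integrable_exp_sq.const_mul 32) pow4_le

section transfer
variable {n : ℕ} {v : Fin n → ℝ}

lemma integral_dotp (hv : vecNorm v = 1) {g : ℝ → ℝ} (hg : Measurable g) :
    ∫ a, g (dotp a v) ∂(stdGaussianVec n) = ∫ x, g x ∂(gaussianReal 0 1) := by
  rw [← law_dotp v hv, integral_map (by fun_prop) (by fun_prop)]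

lemma integrable_dotp (hv : vecNorm v = 1) {g : ℝ → ℝ} (hg : Integrable g (gaussianReal 0 1)) :
    Integrable (fun a => g (dotp a v)) (stdGaussianVec n) := by
  rw [← law_dotp v hv] at hg
  exact hg.comp_measurable (by fun_prop)

lemma integrable_Y (hv : vecNorm v = 1) {Y : (Fin n → ℝ) → ℝ} (hY : Measurable Y)
    (hYb : ∀ a, |Y a| ≤ (dotp a v) ^ 2) : Integrable Y (stdGaussianVec n) :=
  (integrable_dotp hv integrable_sq).mono' hY.aestronglyMeasurable
    (Filter.Eventually.of_forall hYb)

lemma abs_mean_le (hv : vecNorm v = 1) {Y : (Fin n → ℝ) → ℝ}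
    (hYb : ∀ a, |Y a| ≤ (dotp a v) ^ 2) : |∫ a, Y a ∂(stdGaussianVec n)| ≤ 1 := by
  calc |∫ a, Y a ∂(stdGaussianVec n)| ≤ ∫ a, (dotp a v) ^ 2 ∂(stdGaussianVec n) :=
        (Real.norm_eq_abs _).symm.le.trans (norm_integral_le_of_norm_le
          (integrable_dotp hv integrable_sq) (Filter.Eventually.of_forall hYb))
    _ = 1 := by rw [integral_dotp hv (g := fun x => x ^ 2) (by fun_prop), integral_sq]

lemma exp_le_quad (x : ℝ) : Real.exp x ≤ 1 + x + x ^ 2 * Real.exp |x| := by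
  have := Complex.norm_exp_sub_sum_le_norm_mul_exp (x : ℂ) 2
  have h2 : Complex.exp (x : ℂ) - ∑ i ∈ Finset.range 2, (x : ℂ) ^ i / (i.factorial : ℂ)
      = ((Real.exp x - (1 + x) : ℝ) : ℂ) := by
    simp [Finset.sum_range_succ]
  rw [h2, Complex.norm_real, Complex.norm_real, Real.norm_eq_abs, Real.norm_eq_abs, sq_abs] at this
  have := le_of_abs_le this
  linarith

lemma pt_bound {l X s : ℝ} (hl : |l| ≤ 1 / 16) (hX : |X| ≤ s ^ 2 + 1) :
    Real.exp (l * X) ≤ 1 + l * X + 1024 * l ^ 2 * Real.exp (s ^ 2 / 4) := by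
  refine (exp_le_quad _).trans ?_
  have h1 : |l * X| ≤ (s ^ 2 + 1) / 16 := by
    rw [abs_mul]
    calc |l| * |X| ≤ 1 / 16 * (s ^ 2 + 1) := by gcongr
      _ = _ := by ring
  have h2 : X ^ 2 ≤ (s ^ 2 + 1) ^ 2 := by
    rw [← sq_abs X]; gcongr
  have h3 := Real.quadratic_le_exp_of_nonneg (x := (s ^ 2 + 1) / 16) (by positivity)
  have h4 : (s ^ 2 + 1) ^ 2 ≤ 512 * Real.exp ((s ^ 2 + 1) / 16) := by nlinarith [sq_nonneg s]
  have h5 : Real.exp ((s ^ 2 + 1) / 8) ≤ 2 * Real.exp (s ^ 2 / 4) := by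
    have : Real.exp (1/8 : ℝ) ≤ 2 := by
      have := Real.exp_one_lt_d9
      have h := Real.exp_bound' (x := 1/8) (by norm_num) (by norm_num) (n := 1) (by norm_num)
      norm_num at h; linarith
    calc Real.exp ((s ^ 2 + 1) / 8) ≤ Real.exp (1/8 + s^2/4) := by
            apply Real.exp_le_exp.2; nlinarith [sq_nonneg s]
      _ ≤ _ := by rw [Real.exp_add]; gcongr
  have h6 : (l * X) ^ 2 * Real.exp |l * X| ≤ 1024 * l ^ 2 * Real.exp (s ^ 2 / 4) := by
    calc (l * X) ^ 2 * Real.exp |l * X| ≤ l ^ 2 * (512 * Real.exp ((s ^ 2 + 1) / 16)) * Real.exp ((s ^ 2 + 1) / 16) := by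
          rw [mul_pow]; gcongr; exact h2.trans h4
      _ = 512 * l ^ 2 * Real.exp ((s ^ 2 + 1) / 8) := by
          rw [show (s ^ 2 + 1) / 8 = (s ^ 2 + 1) / 16 + (s ^ 2 + 1) / 16 by ring, Real.exp_add]; ring
      _ ≤ 512 * l ^ 2 * (2 * Real.exp (s ^ 2 / 4)) := by gcongr
      _ = _ := by ring
  linarith

lemma mgf_bound (hv : vecNorm v = 1) {Y : (Fin n → ℝ) → ℝ} (hY : Measurable Y)
    (hYb : ∀ a, |Y a| ≤ (dotp a v) ^ 2) {l : ℝ} (hl : |l| ≤ 1 / 16) :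
    Integrable (fun a => Real.exp (l * (Y a - ∫ b, Y b ∂(stdGaussianVec n)))) (stdGaussianVec n) ∧
    ∫ a, Real.exp (l * (Y a - ∫ b, Y b ∂(stdGaussianVec n))) ∂(stdGaussianVec n)
      ≤ Real.exp (1024 * K0 * l ^ 2) := by
  set M := ∫ b, Y b ∂(stdGaussianVec n) with hM
  have hM1 : |M| ≤ 1 := abs_mean_le hv hYb
  have hp : ∀ a, Real.exp (l * (Y a - M)) ≤
      1 + l * (Y a - M) + 1024 * l ^ 2 * Real.exp ((dotp a v) ^ 2 / 4) := fun a =>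
    pt_bound hl ((abs_sub _ _).trans (add_le_add (hYb a) hM1))
  have hIY := integrable_Y hv hY hYb
  have hIX : Integrable (fun a => l * (Y a - M)) (stdGaussianVec n) :=
    (hIY.sub (integrable_const _)).const_mul _
  have hI1 : Integrable (fun a => 1 + l * (Y a - M)) (stdGaussianVec n) :=
    (integrable_const _).add hIX
  have hI2 : Integrable (fun a => 1024 * l ^ 2 * Real.exp ((dotp a v) ^ 2 / 4)) (stdGaussianVec n) :=
    (integrable_dotp hv integrable_exp_sq).const_mul _
  have hI := hI1.add hI2
  have hIe : Integrable (fun a => Real.exp (l * (Y a - M))) (stdGaussianVec n) := by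
    refine hI.mono' (by fun_prop) (Filter.Eventually.of_forall fun a => ?_)
    rw [Real.norm_of_nonneg (Real.exp_nonneg _)]; exact hp a
  refine ⟨hIe, (integral_mono hIe hI hp).trans ?_⟩
  have : ∫ a, (1 + l * (Y a - M) + 1024 * l ^ 2 * Real.exp ((dotp a v) ^ 2 / 4)) ∂(stdGaussianVec n)
      = 1 + 1024 * K0 * l ^ 2 := by
    rw [integral_add hI1 hI2, integral_add (integrable_const _) hIX, integral_const_mul,
      integral_sub hIY (integrable_const _), integral_const_mul,
      integral_dotp hv (g := fun x => Real.exp (x ^ 2 / 4)) (by fun_prop), ← hM]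
    simp [K0]; ring
  have h2 := Real.add_one_le_exp (1024 * K0 * l ^ 2)
  calc _ = _ := this
    _ ≤ _ := by linarith

lemma tail_one (m : ℕ) (hv : vecNorm v = 1) {Y : (Fin n → ℝ) → ℝ} (hY : Measurable Y)
    (hYb : ∀ a, |Y a| ≤ (dotp a v) ^ 2) {t : ℝ} (ht : 0 < t) (ht1 : t ≤ 1) :
    (sampleMeasure m n).real {a | m * t ≤ ∑ k, (Y (a k) - ∫ b, Y b ∂(stdGaussianVec n))}
      ≤ Real.exp (-(1 / (4096 * K0) * m * t ^ 2)) := by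
  set M := ∫ b, Y b ∂(stdGaussianVec n) with hM
  have hK := one_le_K0
  set l : ℝ := t / (2 * (1024 * K0)) with hl
  have hl0 : 0 < l := by positivity
  have hl1 : |l| ≤ 1 / 16 := by
    rw [abs_of_pos hl0, hl, div_le_div_iff₀ (by positivity) (by norm_num)]; linarith
  obtain ⟨hI, hm⟩ := mgf_bound hv hY hYb hl1
  have hprod : ∀ a : Fin m → Fin n → ℝ, Real.exp (l * ∑ k, (Y (a k) - M)) =
      ∏ k, Real.exp (l * (Y (a k) - M)) := fun a => by
    rw [← Real.exp_sum, Finset.mul_sum]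
  have hIS : Integrable (fun a : Fin m → Fin n → ℝ => Real.exp (l * ∑ k, (Y (a k) - M)))
      (sampleMeasure m n) := by
    simp_rw [hprod]
    exact Integrable.fintype_prod (f := fun _ x => Real.exp (l * (Y x - M))) (fun _ => hI)
  have hE : ∫ a, Real.exp (l * ∑ k, (Y (a k) - M)) ∂(sampleMeasure m n)
      ≤ Real.exp (m * (1024 * K0 * l ^ 2)) := by
    simp_rw [hprod]
    unfold sampleMeasure
    rw [integral_fintype_prod_eq_prod (fun _ x => Real.exp (l * (Y x - M)))]
    simp only [Finset.prod_const, Finset.card_univ, Fintype.card_fin]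
    rw [Real.exp_nat_mul]
    gcongr
  have hmk := mul_meas_ge_le_integral_of_nonneg
    (Filter.Eventually.of_forall fun a => (Real.exp_nonneg _)) hIS (Real.exp (l * (m * t)))
  have hset : {a : Fin m → Fin n → ℝ | m * t ≤ ∑ k, (Y (a k) - M)} =
      {a | Real.exp (l * (m * t)) ≤ Real.exp (l * ∑ k, (Y (a k) - M))} := by
    ext a; simp only [Set.mem_ofPred_eq, Real.exp_le_exp]
    exact (mul_le_mul_iff_right₀ hl0).symm
  rw [hset]
  have h3 := hmk.trans hE
  rw [← le_div_iff₀' (Real.exp_pos _), ← Real.exp_sub] at h3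
  refine h3.trans (le_of_eq ?_)
  congr 1
  rw [hl]; field_simp; ring

lemma tail_two {m : ℕ} (hm : 0 < m) (hv : vecNorm v = 1) {Y : (Fin n → ℝ) → ℝ} (hY : Measurable Y)
    (hYb : ∀ a, |Y a| ≤ (dotp a v) ^ 2) {t : ℝ} (ht : 0 < t) (ht1 : t ≤ 1) :
    (sampleMeasure m n).real {a | t ≤ |(1 / (m:ℝ)) * ∑ k, Y (a k) - ∫ b, Y b ∂(stdGaussianVec n)|}
      ≤ 2 * Real.exp (-(1 / (4096 * K0) * m * t ^ 2)) := by
  have h1 := tail_one m hv hY hYb ht ht1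
  have h2 := tail_one m hv (Y := fun a => - Y a) hY.neg (by simpa using hYb) ht ht1
  have hm' : (0:ℝ) < m := by exact_mod_cast hm
  calc _ ≤ (sampleMeasure m n).real ({a | m * t ≤ ∑ k, (Y (a k) - ∫ b, Y b ∂(stdGaussianVec n))}
      ∪ {a | m * t ≤ ∑ k, (-Y (a k) - ∫ b, -Y b ∂(stdGaussianVec n))}) := by
        apply measureReal_mono _ (by finiteness)
        intro a ha
        simp only [Set.mem_ofPred_eq, Set.mem_union, integral_neg, Finset.sum_sub_distrib,
          Finset.sum_neg_distrib, Finset.sum_const, Finset.card_univ, Fintype.card_fin, nsmul_eq_mul] at ha ⊢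
        rcases le_abs.1 ha with h | h
        · left
          have := mul_le_mul_of_nonneg_left h hm'.le
          rw [mul_sub, ← mul_assoc, mul_one_div_cancel hm'.ne', one_mul] at this
          exact this
        · right
          have := mul_le_mul_of_nonneg_left h hm'.le
          rw [mul_neg, mul_sub, ← mul_assoc, mul_one_div_cancel hm'.ne', one_mul] at this
          linarith
    _ ≤ _ := (measureReal_union_le _ _).trans (by linarith)

end transfer

lemma card_sep {E : Type*} [NormedAddCommGroup E] [NormedSpace ℝ E] [FiniteDimensional ℝ E]
    {η : ℝ} (hη : 0 < η) (hη1 : η ≤ 1) (s : Finset E) (hs : ∀ c ∈ s, ‖c‖ ≤ 1)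
    (h : ∀ c ∈ s, ∀ d ∈ s, c ≠ d → η ≤ ‖c - d‖) :
    (s.card : ℝ) ≤ (3 / η) ^ Module.finrank ℝ E := by
  borelize E
  let μ : Measure E := Measure.addHaar
  have hδ : 0 < η / 2 := by linarith
  have hρ : (0:ℝ) < 3 / 2 := by norm_num
  set A := ⋃ c ∈ s, Metric.ball (c : E) (η / 2) with hA
  have D : Set.Pairwise (s : Set E) (Function.onFun Disjoint fun c => Metric.ball (c : E) (η / 2)) := by
    rintro c hc d hd hcd
    apply Metric.ball_disjoint_ball
    rw [dist_eq_norm]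
    have := h c hc d hd hcd
    linarith
  have A_subset : A ⊆ Metric.ball (0 : E) (3 / 2) := by
    refine Set.iUnion₂_subset fun x hx => ?_
    apply Metric.ball_subset_ball'
    rw [dist_zero_right]
    have := hs x hx
    linarith
  have I : (s.card : ENNReal) * ENNReal.ofReal ((η / 2) ^ Module.finrank ℝ E) * μ (Metric.ball 0 1) ≤
      ENNReal.ofReal ((3 / 2) ^ Module.finrank ℝ E) * μ (Metric.ball 0 1) :=
    calc
      (s.card : ENNReal) * ENNReal.ofReal ((η / 2) ^ Module.finrank ℝ E) * μ (Metric.ball 0 1) = μ A := by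
        rw [hA, measure_biUnion_finset D fun c _ => Metric.isOpen_ball.measurableSet]
        simp only [μ.addHaar_ball_of_pos _ hδ]
        simp only [Finset.sum_const, nsmul_eq_mul, mul_assoc]
      _ ≤ μ (Metric.ball (0 : E) (3 / 2)) := measure_mono A_subset
      _ = ENNReal.ofReal ((3 / 2) ^ Module.finrank ℝ E) * μ (Metric.ball 0 1) := by
        simp only [μ.addHaar_ball_of_pos _ hρ]
  have J : (s.card : ENNReal) * ENNReal.ofReal ((η / 2) ^ Module.finrank ℝ E) ≤
      ENNReal.ofReal ((3 / 2) ^ Module.finrank ℝ E) :=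
    (ENNReal.mul_le_mul_iff_left (Metric.measure_ball_pos _ _ zero_lt_one).ne' measure_ball_lt_top.ne).1 I
  have K := ENNReal.toReal_le_of_le_ofReal (pow_nonneg hρ.le _) J
  rw [ENNReal.toReal_mul, ENNReal.toReal_ofReal (by positivity), ENNReal.toReal_natCast,
    ← le_div_iff₀ (by positivity), ← div_pow] at K
  have e : (3:ℝ) / 2 / (η / 2) = 3 / η := by field_simp
  rwa [e] at K

lemma exists_net' (n : ℕ) {η : ℝ} (hη : 0 < η) (hη1 : η ≤ 1) :
    ∃ N : Finset (EuclideanSpace ℝ (Fin n)), (∀ c ∈ N, ‖c‖ = 1) ∧ ((N.card : ℝ) ≤ (3 / η) ^ n) ∧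
      ∀ x : EuclideanSpace ℝ (Fin n), ‖x‖ = 1 → ∃ c ∈ N, ‖x - c‖ ≤ η := by
  classical
  let P : Finset (EuclideanSpace ℝ (Fin n)) → Prop := fun s => (∀ c ∈ s, ‖c‖ = 1) ∧
    ∀ c ∈ s, ∀ d ∈ s, c ≠ d → η ≤ ‖c - d‖
  have hb : ∀ s, P s → (s.card : ℝ) ≤ (3 / η) ^ n := fun s hs => by
    simpa using card_sep hη hη1 s (fun c hc => (hs.1 c hc).le) hs.2
  let Q : ℕ → Prop := fun k => ∃ s, P s ∧ s.card = k
  obtain ⟨B, hB⟩ := exists_nat_ge ((3 / η) ^ n)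
  have hQ0 : Q 0 := ⟨∅, ⟨by simp, by simp⟩, rfl⟩
  have hQ : Q (Nat.findGreatest Q B) := Nat.findGreatest_spec (Nat.zero_le B) hQ0
  obtain ⟨s, hs, hcard⟩ := hQ
  refine ⟨s, hs.1, hb s hs, fun x hx => ?_⟩
  by_contra! hcon
  have hxs : x ∉ s := fun h => by
    have := hcon x h; simp at this; linarith
  have hP : P (insert x s) := by
    refine ⟨fun c hc => ?_, fun c hc d hd hcd => ?_⟩
    · rcases Finset.mem_insert.1 hc with rfl | hc
      · exact hx
      · exact hs.1 c hc
    · rcases Finset.mem_insert.1 hc with rfl | hc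
      · rcases Finset.mem_insert.1 hd with rfl | hd
        · exact absurd rfl hcd
        · exact (hcon d hd).le
      · rcases Finset.mem_insert.1 hd with hdx | hd
        · rw [norm_sub_rev, hdx]; exact (hcon c (by assumption)).le
        · exact hs.2 c (by assumption) d hd hcd
  have hle : (insert x s).card ≤ B := by
    have := (hb _ hP).trans hB
    exact_mod_cast this
  have := Nat.le_findGreatest (P := Q) hle ⟨_, hP, rfl⟩
  rw [Finset.card_insert_of_notMem hxs, hcard] at this
  omega

lemma exists_net (n : ℕ) {η : ℝ} (hη : 0 < η) (hη1 : η ≤ 1) :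
    ∃ N : Finset (Fin n → ℝ), (∀ c ∈ N, vecNorm c = 1) ∧ ((N.card : ℝ) ≤ (3 / η) ^ n) ∧
      ∀ x : Fin n → ℝ, vecNorm x = 1 → ∃ c ∈ N, vecNorm (x - c) ≤ η := by
  classical
  obtain ⟨N, h1, h2, h3⟩ := exists_net' n hη hη1
  refine ⟨N.image (fun c => WithLp.ofLp c), fun c hc => ?_, ?_, fun x hx => ?_⟩
  · obtain ⟨d, hd, rfl⟩ := Finset.mem_image.1 hc
    rw [vecNorm_eq]; exact h1 d hd
  · refine le_trans ?_ h2
    exact_mod_cast Finset.card_image_le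
  · rw [vecNorm_eq] at hx
    obtain ⟨c, hc, h⟩ := h3 _ hx
    refine ⟨_, Finset.mem_image_of_mem _ hc, ?_⟩
    rw [vecNorm_eq]; exact h

lemma window_prob (γ : ℝ) {δ : ℝ} (hδ : 0 ≤ δ) :
    (gaussianReal 0 1).real {x : ℝ | |(|x| - γ)| ≤ δ} ≤ 4 * δ := by
  have hle : gaussianReal 0 1 ≤ (volume : Measure ℝ) := by
    rw [gaussianReal_of_var_ne_zero _ (by simp)]
    refine (withDensity_mono (g := 1) (Filter.Eventually.of_forall fun x => ?_)).trans_eq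
      withDensity_one
    rw [gaussianPDF_def]
    refine ENNReal.ofReal_le_one.2 ?_
    rw [gaussianPDFReal]
    have h1 : (√(2 * Real.pi * (1 : NNReal)))⁻¹ ≤ 1 := by
      apply inv_le_one_of_one_le₀
      rw [Real.one_le_sqrt]; have := Real.pi_gt_three; simp; linarith
    have h2 : Real.exp (-(x - 0) ^ 2 / (2 * (1 : NNReal))) ≤ 1 := by
      apply Real.exp_le_one_iff.2
      simp; nlinarith [sq_nonneg x]
    exact mul_le_one₀ h1 (Real.exp_nonneg _) h2
  have hsub : {x : ℝ | |(|x| - γ)| ≤ δ} ⊆ Set.Icc (γ - δ) (γ + δ) ∪ Set.Icc (-γ - δ) (-γ + δ) := by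
    intro x hx
    simp only [Set.mem_ofPred_eq] at hx
    rw [abs_le] at hx
    rcases le_total 0 x with h | h
    · rw [abs_of_nonneg h] at hx; left; constructor <;> linarith
    · rw [abs_of_nonpos h] at hx; right; constructor <;> linarith
  have h1 : gaussianReal 0 1 {x : ℝ | |(|x| - γ)| ≤ δ} ≤ ENNReal.ofReal (4 * δ) := by
    calc _ ≤ volume {x : ℝ | |(|x| - γ)| ≤ δ} := hle _
      _ ≤ _ := measure_mono hsub
      _ ≤ _ := measure_union_le _ _
      _ = _ := by
        rw [Real.volume_Icc, Real.volume_Icc, ← ENNReal.ofReal_add (by linarith) (by linarith)]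
        congr 1; ring
  exact ENNReal.toReal_le_of_le_ofReal (by positivity) h1

lemma tail_prob {τ : ℝ} (hτ : 0 < τ) :
    (gaussianReal 0 1).real {x : ℝ | τ < |x|} ≤ 1 / τ ^ 2 := by
  have h := mul_meas_ge_le_integral_of_nonneg (μ := gaussianReal 0 1) (f := fun x : ℝ => x ^ 2)
    (Filter.Eventually.of_forall fun a => sq_nonneg a) integrable_sq (τ ^ 2)
  rw [integral_sq] at h
  rw [le_div_iff₀' (by positivity)]
  refine le_trans ?_ h
  gcongr
  · finiteness
  · intro hx
    rw [← sq_abs x]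
    have hx' : τ < |x| := hx
    gcongr

/-- Truncated square. -/
noncomputable def tr (γ s : ℝ) : ℝ := if |s| ≤ γ then s ^ 2 else 0

@[fun_prop]
lemma measurable_tr (γ : ℝ) : Measurable (tr γ) := by
  unfold tr
  exact Measurable.ite (measurableSet_le (by fun_prop) (by fun_prop)) (by fun_prop) (by fun_prop)

lemma tr_nonneg (γ s : ℝ) : 0 ≤ tr γ s := by unfold tr; split_ifs <;> positivity

lemma tr_le (γ s : ℝ) : tr γ s ≤ γ ^ 2 := by
  unfold tr; split_ifs with h
  · rw [← sq_abs]; gcongr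
  · positivity

lemma dotp_add_right {n : ℕ} (a v w : Fin n → ℝ) : dotp a (v + w) = dotp a v + dotp a w := by
  simp [dotp, mul_add, Finset.sum_add_distrib]
lemma dotp_sub_right {n : ℕ} (a v w : Fin n → ℝ) : dotp a (v - w) = dotp a v - dotp a w := by
  simp [dotp, mul_sub, Finset.sum_sub_distrib]
lemma dotp_smul_right {n : ℕ} (a v : Fin n → ℝ) (c : ℝ) : dotp a (c • v) = c * dotp a v := by
  simp [dotp, Finset.mul_sum, mul_left_comm]
lemma dotp_comm {n : ℕ} (a v : Fin n → ℝ) : dotp a v = dotp v a := by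
  simp [dotp, mul_comm]

lemma second_moment {n : ℕ} (v : Fin n → ℝ) :
    ∫ a, (dotp a v) ^ 2 ∂(stdGaussianVec n) = vecNorm v ^ 2 := by
  have h := cov_dotp v v
  rw [covariance, mean_dotp] at h
  rw [vecNorm_sq, ← h]
  simp [sq]

lemma memLp_dotp {n : ℕ} (v : Fin n → ℝ) : MemLp (fun a => dotp a v) 2 (stdGaussianVec n) :=
  (gauss_pair v v).fst.memLp_two

lemma bdd_mul_int {n : ℕ} {γ : ℝ} (z : Fin n → ℝ) {g : (Fin n → ℝ) → ℝ}
    (hg : Integrable g (stdGaussianVec n)) :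
    Integrable (fun a => tr γ (dotp a z) * g a) (stdGaussianVec n) := by
  refine hg.bdd_mul (c := γ ^ 2) ?_ (Filter.Eventually.of_forall fun a => ?_)
  · apply Measurable.aestronglyMeasurable; fun_prop
  · rw [Real.norm_of_nonneg (tr_nonneg _ _)]; exact tr_le _ _

lemma population {n : ℕ} (γ : ℝ) (z v : Fin n → ℝ) (hz : vecNorm z = 1) (hv : vecNorm v = 1) :
    ∫ a, tr γ (dotp a z) * (dotp a v) ^ 2 ∂(stdGaussianVec n) =
      ((∫ t in {s : ℝ | |s| ≤ γ}, t^4 ∂(gaussianReal 0 1))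
        - ∫ t in {s : ℝ | |s| ≤ γ}, t^2 ∂(gaussianReal 0 1)) * (dotp z v) ^ 2
      + ∫ t in {s : ℝ | |s| ≤ γ}, t^2 ∂(gaussianReal 0 1) := by
  have hmS : MeasurableSet {s : ℝ | |s| ≤ γ} := measurableSet_le (by fun_prop) (by fun_prop)
  have e4 : ∫ t in {s : ℝ | |s| ≤ γ}, t^4 ∂(gaussianReal 0 1)
      = ∫ a, tr γ (dotp a z) * (dotp a z) ^ 2 ∂(stdGaussianVec n) := by
    rw [integral_dotp hz (g := fun s => tr γ s * s ^ 2) (by fun_prop), ← integral_indicator hmS]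
    congr 1; ext s; simp only [Set.indicator, tr, Set.mem_ofPred_eq]; split_ifs <;> ring
  have e2 : ∫ t in {s : ℝ | |s| ≤ γ}, t^2 ∂(gaussianReal 0 1)
      = ∫ a, tr γ (dotp a z) ∂(stdGaussianVec n) := by
    rw [integral_dotp hz (g := fun s => tr γ s) (by fun_prop), ← integral_indicator hmS]
    congr 1
  set p := dotp z v with hp
  set w := v - p • z with hw
  have hzz : dotp z z = 1 := by rw [← vecNorm_sq, hz]; norm_num
  have hvv : dotp v v = 1 := by rw [← vecNorm_sq, hv]; norm_num
  have hzw : dotp z w = 0 := by rw [hw, dotp_sub_right, dotp_smul_right, hzz, ← hp]; ring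
  have hww : vecNorm w ^ 2 = 1 - p ^ 2 := by
    have : dotp w w = dotp w v - p * dotp w z := by
      conv_lhs => rw [hw, dotp_sub_right, dotp_smul_right, ← hw]
    rw [vecNorm_sq, this, dotp_comm w z, hzw, dotp_comm w v, hw, dotp_sub_right, dotp_smul_right, hvv,
      dotp_comm v z, ← hp]; ring
  have hind := indep_dotp z w hzw
  have hav : ∀ a, dotp a v = p * dotp a z + dotp a w := fun a => by
    rw [hw, dotp_sub_right, dotp_smul_right]; ring
  have i1 : ∫ a, (tr γ (dotp a z) * dotp a z) * dotp a w ∂(stdGaussianVec n) = 0 := by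
    have := hind.integral_fun_comp_mul_comp (f := fun s => tr γ s * s) (g := id)
      (by fun_prop) (by fun_prop) (Measurable.aestronglyMeasurable (by fun_prop))
      (Measurable.aestronglyMeasurable (by fun_prop))
    simp only [id] at this
    rw [this, mean_dotp, mul_zero]
  have i2 : ∫ a, tr γ (dotp a z) * (dotp a w) ^ 2 ∂(stdGaussianVec n)
      = (∫ a, tr γ (dotp a z) ∂(stdGaussianVec n)) * (1 - p ^ 2) := by
    have := hind.integral_fun_comp_mul_comp (f := fun s => tr γ s) (g := fun s => s ^ 2)
      (by fun_prop) (by fun_prop) (Measurable.aestronglyMeasurable (by fun_prop))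
      (Measurable.aestronglyMeasurable (by fun_prop))
    rw [this, second_moment, hww]
  have I1 : Integrable (fun a => tr γ (dotp a z) * (dotp a z) ^ 2) (stdGaussianVec n) :=
    bdd_mul_int z (memLp_dotp z).integrable_sq
  have I2 : Integrable (fun a => tr γ (dotp a z) * (dotp a w) ^ 2) (stdGaussianVec n) :=
    bdd_mul_int z (memLp_dotp w).integrable_sq
  have I3 : Integrable (fun a => (tr γ (dotp a z) * dotp a z) * dotp a w) (stdGaussianVec n) := by
    simp_rw [mul_assoc]
    exact bdd_mul_int z ((memLp_dotp z).integrable_mul (memLp_dotp w))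
  have : ∀ a, tr γ (dotp a z) * (dotp a v) ^ 2 = p ^ 2 * (tr γ (dotp a z) * (dotp a z) ^ 2)
      + 2 * p * ((tr γ (dotp a z) * dotp a z) * dotp a w) + tr γ (dotp a z) * (dotp a w) ^ 2 :=
    fun a => by rw [hav]; ring
  simp_rw [this]
  have I13 : Integrable (fun a => p ^ 2 * (tr γ (dotp a z) * (dotp a z) ^ 2)
      + 2 * p * ((tr γ (dotp a z) * dotp a z) * dotp a w)) (stdGaussianVec n) :=
    (I1.const_mul _).add (I3.const_mul _)
  rw [integral_add I13 I2, integral_add (I1.const_mul _) (I3.const_mul _), integral_const_mul, integral_const_mul,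
    i1, i2, e4, e2]
  ring

/-- The square `x²` on the exceptional set (window in `s`, large `x`). -/
noncomputable def yb (γ δ τ s x : ℝ) : ℝ := if |(|s| - γ)| ≤ δ ∨ τ < |x| then x ^ 2 else 0

lemma yb_nonneg (γ δ τ s x : ℝ) : 0 ≤ yb γ δ τ s x := by unfold yb; split_ifs <;> positivity

lemma yb_le (γ δ τ s x : ℝ) : yb γ δ τ s x ≤ x ^ 2 := by
  unfold yb; split_ifs
  · exact le_rfl
  · positivity

lemma measurable_yb {Ω : Type*} [MeasurableSpace Ω] {s x : Ω → ℝ} (hs : Measurable s)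
    (hx : Measurable x) (γ δ τ : ℝ) : Measurable (fun ω => yb γ δ τ (s ω) (x ω)) := by
  unfold yb
  refine Measurable.ite ?_ (by fun_prop) (by fun_prop)
  exact (measurableSet_le (f := fun ω => |(|s ω| - γ)|) (by fun_prop) (by fun_prop)).union
    (measurableSet_lt (f := fun _ => τ) (g := fun ω => |x ω|) (by fun_prop) (by fun_prop))

lemma tr_diff {γ δ s t : ℝ} (hγ : 0 ≤ γ) (hδ : 0 < δ) (h : δ < |(|t| - γ)|) :
    |tr γ s - tr γ t| ≤ 2 * γ * |s - t| + γ ^ 2 * (s - t) ^ 2 / δ ^ 2 := by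
  have hst : |(|s| - |t|)| ≤ |s - t| := abs_abs_sub_abs_le s t
  have hkey : δ ≤ |s - t| → γ ^ 2 ≤ 2 * γ * |s - t| + γ ^ 2 * (s - t) ^ 2 / δ ^ 2 := fun hd => by
    have h1 : γ ^ 2 ≤ γ ^ 2 * (s - t) ^ 2 / δ ^ 2 := by
      rw [le_div_iff₀ (by positivity), ← sq_abs (s - t)]
      gcongr
    have : 0 ≤ 2 * γ * |s - t| := by positivity
    linarith
  have h0 : 0 ≤ 2 * γ * |s - t| + γ ^ 2 * (s - t) ^ 2 / δ ^ 2 := by positivity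
  unfold tr
  split_ifs with h1 h2 h2
  · rw [show s ^ 2 - t ^ 2 = (s + t) * (s - t) by ring, abs_mul]
    have : |s + t| ≤ 2 * γ := (abs_add_le s t).trans (by linarith)
    have h3 : |s + t| * |s - t| ≤ 2 * γ * |s - t| := by gcongr
    have : 0 ≤ γ ^ 2 * (s - t) ^ 2 / δ ^ 2 := by positivity
    linarith
  · rw [sub_zero, abs_of_nonneg (by positivity), ← sq_abs]
    refine le_trans (by gcongr) (hkey ?_)
    push Not at h2
    rw [abs_of_pos (by linarith)] at h
    have := (abs_le.1 hst).1
    linarith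
  · rw [zero_sub, abs_neg, abs_of_nonneg (by positivity), ← sq_abs]
    refine le_trans (by gcongr) (hkey ?_)
    push Not at h1
    rw [abs_of_nonpos (by linarith)] at h
    have := (abs_le.1 hst).2
    linarith
  · simpa using h0

lemma pointwise {γ δ τ θ ε s t x y : ℝ} (hγ : 0 ≤ γ) (hδ : 0 < δ) (hθ : 0 < θ)
    (hε : 0 < ε) :
    |tr γ s * x ^ 2 - tr γ t * y ^ 2| ≤ γ ^ 2 * θ * x ^ 2 + γ ^ 2 * θ * y ^ 2
      + γ ^ 2 / (2 * θ) * (x - y) ^ 2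
      + γ ^ 2 * yb γ δ τ t y + ε + γ ^ 2 * (τ ^ 4 / ε + τ ^ 2 / δ ^ 2) * (s - t) ^ 2 := by
  have e : tr γ s * x ^ 2 - tr γ t * y ^ 2 = tr γ s * (x ^ 2 - y ^ 2) + (tr γ s - tr γ t) * y ^ 2 := by
    ring
  have h1 : |tr γ s * (x ^ 2 - y ^ 2)| ≤ γ ^ 2 * θ * x ^ 2 + γ ^ 2 * θ * y ^ 2
      + γ ^ 2 / (2 * θ) * (x - y) ^ 2 := by
    have ha : |x ^ 2 - y ^ 2| ≤ θ * x ^ 2 + θ * y ^ 2 + 1 / (2 * θ) * (x - y) ^ 2 := by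
      have e1 : |x ^ 2 - y ^ 2| = |x + y| * |x - y| := by
        rw [← abs_mul]; congr 1; ring
      have e2 : (x - y) ^ 2 = (2 * θ) * (1 / (2 * θ) * (x - y) ^ 2) := by field_simp
      set q := 1 / (2 * θ) * (x - y) ^ 2 with hq
      have h3 : |x + y| * |x - y| ≤ θ / 2 * |x + y| ^ 2 + q := by
        have : q = |x - y| ^ 2 / (2 * θ) := by rw [hq, sq_abs]; ring
        rw [this]
        have := sq_nonneg (θ * |x + y| - |x - y|)
        have e3 : θ / 2 * |x + y| ^ 2 + |x - y| ^ 2 / (2 * θ) - |x + y| * |x - y|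
          = (θ * |x + y| - |x - y|) ^ 2 / (2 * θ) := by field_simp; ring
        have : 0 ≤ (θ * |x + y| - |x - y|) ^ 2 / (2 * θ) := by positivity
        linarith
      rw [sq_abs] at h3
      rw [e1]
      nlinarith [sq_nonneg (x - y)]
    rw [abs_mul, abs_of_nonneg (tr_nonneg _ _)]
    calc tr γ s * |x ^ 2 - y ^ 2| ≤ γ ^ 2 * (θ * x ^ 2 + θ * y ^ 2 + 1 / (2 * θ) * (x - y) ^ 2) :=
          mul_le_mul (tr_le _ _) ha (abs_nonneg _) (by positivity)
      _ = _ := by ring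
  have h2 : |(tr γ s - tr γ t) * y ^ 2| ≤ γ ^ 2 * yb γ δ τ t y + ε
      + γ ^ 2 * (τ ^ 4 / ε + τ ^ 2 / δ ^ 2) * (s - t) ^ 2 := by
    rw [abs_mul, abs_of_nonneg (sq_nonneg y)]
    by_cases hb : |(|t| - γ)| ≤ δ ∨ τ < |y|
    · have : |tr γ s - tr γ t| ≤ γ ^ 2 := by
        rw [abs_le]; constructor <;>
        linarith [tr_nonneg γ s, tr_nonneg γ t, tr_le γ s, tr_le γ t]
      have e3 : yb γ δ τ t y = y ^ 2 := by simp [yb, hb]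
      rw [e3]
      have : |tr γ s - tr γ t| * y ^ 2 ≤ γ ^ 2 * y ^ 2 := by gcongr
      have : 0 ≤ γ ^ 2 * (τ ^ 4 / ε + τ ^ 2 / δ ^ 2) * (s - t) ^ 2 := by positivity
      linarith
    · have e3 : yb γ δ τ t y = 0 := by simp [yb, hb]
      rw [e3]
      push Not at hb
      have hd := tr_diff (s := s) hγ hδ hb.1
      have hy : y ^ 2 ≤ τ ^ 2 := by rw [← sq_abs]; gcongr; exact hb.2
      have h5 : |tr γ s - tr γ t| * y ^ 2 ≤
          (2 * γ * |s - t| + γ ^ 2 * (s - t) ^ 2 / δ ^ 2) * τ ^ 2 := by gcongr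
      have h6 : 2 * γ * |s - t| * τ ^ 2 ≤ ε + γ ^ 2 * (τ ^ 4 / ε) * (s - t) ^ 2 := by
        rw [← sq_abs (s - t)]
        have e4 : ε + γ ^ 2 * (τ ^ 4 / ε) * |s - t| ^ 2 - 2 * γ * |s - t| * τ ^ 2
          = (ε - γ * |s - t| * τ ^ 2) ^ 2 / ε := by field_simp; ring
        have : 0 ≤ (ε - γ * |s - t| * τ ^ 2) ^ 2 / ε := by positivity
        linarith
      have e7 : γ ^ 2 * (s - t) ^ 2 / δ ^ 2 * τ ^ 2 = γ ^ 2 * (τ ^ 2 / δ ^ 2) * (s - t) ^ 2 := by ring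
      nlinarith
  rw [e]
  refine (abs_add_le _ _).trans ?_
  linarith

lemma compare {Ω : Type*} [MeasurableSpace Ω] (ν : Measure Ω) [IsProbabilityMeasure ν]
    {s t x y : Ω → ℝ} (ms : Measurable s) (mt : Measurable t) (mx : Measurable x) (my : Measurable y)
    (hs : MemLp s 2 ν) (ht : MemLp t 2 ν) (hx : MemLp x 2 ν) (hy : MemLp y 2 ν)
    {γ δ τ θ ε β η : ℝ} (hγ : 0 ≤ γ) (hδ : 0 < δ) (hθ : 0 < θ) (hε : 0 < ε)
    (bx : ∫ ω, x ω ^ 2 ∂ν ≤ 4) (bY : ∫ ω, y ω ^ 2 ∂ν ≤ 4)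
    (bxy : ∫ ω, (x ω - y ω) ^ 2 ∂ν ≤ 4 * η ^ 2) (bst : ∫ ω, (s ω - t ω) ^ 2 ∂ν ≤ 4 * η ^ 2)
    (bb : ∫ ω, yb γ δ τ (t ω) (y ω) ∂ν ≤ β) :
    |∫ ω, tr γ (s ω) * x ω ^ 2 ∂ν - ∫ ω, tr γ (t ω) * y ω ^ 2 ∂ν| ≤
      γ ^ 2 * (8 * θ + 2 * η ^ 2 / θ) + γ ^ 2 * β + ε
        + γ ^ 2 * (τ ^ 4 / ε + τ ^ 2 / δ ^ 2) * (4 * η ^ 2) := by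
  have bdd : ∀ {p q : Ω → ℝ}, Measurable p → Measurable q → MemLp q 2 ν →
      Integrable (fun ω => tr γ (p ω) * q ω ^ 2) ν := by
    intro p q mp mq hq
    refine hq.integrable_sq.bdd_mul (c := γ ^ 2) ?_ (Filter.Eventually.of_forall fun a => ?_)
    · apply Measurable.aestronglyMeasurable; fun_prop
    · rw [Real.norm_of_nonneg (tr_nonneg _ _)]; exact tr_le _ _
  have I1 := hx.integrable_sq
  have I2 := hy.integrable_sq
  have I3 : Integrable (fun ω => (x ω - y ω) ^ 2) ν := (hx.sub hy).integrable_sq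
  have I4 : Integrable (fun ω => (s ω - t ω) ^ 2) ν := (hs.sub ht).integrable_sq
  have I5 : Integrable (fun ω => yb γ δ τ (t ω) (y ω)) ν := by
    refine I2.mono' (measurable_yb mt my _ _ _).aestronglyMeasurable
      (Filter.Eventually.of_forall fun ω => ?_)
    rw [Real.norm_of_nonneg (yb_nonneg _ _ _ _ _)]; exact yb_le _ _ _ _ _
  have J1 := I1.const_mul (γ ^ 2 * θ)
  have J2 := I2.const_mul (γ ^ 2 * θ)
  have J3 := I3.const_mul (γ ^ 2 / (2 * θ))
  have J4 := I4.const_mul (γ ^ 2 * (τ ^ 4 / ε + τ ^ 2 / δ ^ 2))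
  have J5 := I5.const_mul (γ ^ 2)
  have J6 : Integrable (fun _ : Ω => ε) ν := integrable_const _
  have K1 : Integrable (fun ω => γ ^ 2 * θ * x ω ^ 2 + γ ^ 2 * θ * y ω ^ 2) ν := J1.add J2
  have K2 : Integrable (fun ω => γ ^ 2 * θ * x ω ^ 2 + γ ^ 2 * θ * y ω ^ 2
      + γ ^ 2 / (2 * θ) * (x ω - y ω) ^ 2) ν := K1.add J3
  have K3 : Integrable (fun ω => γ ^ 2 * θ * x ω ^ 2 + γ ^ 2 * θ * y ω ^ 2
      + γ ^ 2 / (2 * θ) * (x ω - y ω) ^ 2 + γ ^ 2 * yb γ δ τ (t ω) (y ω)) ν := K2.add J5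
  have K4 : Integrable (fun ω => γ ^ 2 * θ * x ω ^ 2 + γ ^ 2 * θ * y ω ^ 2
      + γ ^ 2 / (2 * θ) * (x ω - y ω) ^ 2 + γ ^ 2 * yb γ δ τ (t ω) (y ω) + ε) ν := K3.add J6
  have K5 : Integrable (fun ω => γ ^ 2 * θ * x ω ^ 2 + γ ^ 2 * θ * y ω ^ 2
      + γ ^ 2 / (2 * θ) * (x ω - y ω) ^ 2 + γ ^ 2 * yb γ δ τ (t ω) (y ω) + ε
      + γ ^ 2 * (τ ^ 4 / ε + τ ^ 2 / δ ^ 2) * (s ω - t ω) ^ 2) ν := K4.add J4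
  rw [← integral_sub (bdd ms mx hx) (bdd mt my hy)]
  have hmain := norm_integral_le_of_norm_le (f := fun ω => tr γ (s ω) * x ω ^ 2 - tr γ (t ω) * y ω ^ 2)
    K5 (Filter.Eventually.of_forall fun ω => by
      rw [Real.norm_eq_abs]; exact pointwise hγ hδ hθ hε)
  rw [Real.norm_eq_abs] at hmain
  refine hmain.trans ?_
  rw [integral_add K4 J4, integral_add K3 J6, integral_add K2 J5, integral_add K1 J3,
    integral_add J1 J2, integral_const_mul, integral_const_mul, integral_const_mul,
    integral_const_mul, integral_const_mul]
  simp only [integral_const, probReal_univ, smul_eq_mul, one_mul]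
  have a1 := mul_le_mul_of_nonneg_left bx (show 0 ≤ γ ^ 2 * θ by positivity)
  have a2 := mul_le_mul_of_nonneg_left bY (show 0 ≤ γ ^ 2 * θ by positivity)
  have a3 := mul_le_mul_of_nonneg_left bxy (show 0 ≤ γ ^ 2 / (2 * θ) by positivity)
  have a4 := mul_le_mul_of_nonneg_left bst
    (show 0 ≤ γ ^ 2 * (τ ^ 4 / ε + τ ^ 2 / δ ^ 2) by positivity)
  have a5 := mul_le_mul_of_nonneg_left bb (show 0 ≤ γ ^ 2 by positivity)
  have e : γ ^ 2 / (2 * θ) * (4 * η ^ 2) = γ ^ 2 * (2 * η ^ 2 / θ) := by field_simp; norm_num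
  rw [e] at a3
  linarith

/-- Specialisation of the parameters. -/
lemma compare' {Ω : Type*} [MeasurableSpace Ω] (ν : Measure Ω) [IsProbabilityMeasure ν]
    {s t x y : Ω → ℝ} (ms : Measurable s) (mt : Measurable t) (mx : Measurable x) (my : Measurable y)
    (hs : MemLp s 2 ν) (ht : MemLp t 2 ν) (hx : MemLp x 2 ν) (hy : MemLp y 2 ν)
    {γ ε β : ℝ} (hγ : 2 ≤ γ) (hε : 0 < ε) (hε1 : ε ≤ 1 / 100)
    (bx : ∫ ω, x ω ^ 2 ∂ν ≤ 4) (bY : ∫ ω, y ω ^ 2 ∂ν ≤ 4)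
    (bxy : ∫ ω, (x ω - y ω) ^ 2 ∂ν ≤ 4 * (ε ^ 7) ^ 2)
    (bst : ∫ ω, (s ω - t ω) ^ 2 ∂ν ≤ 4 * (ε ^ 7) ^ 2)
    (bb : ∫ ω, yb γ (ε ^ 4) ((ε ^ 2)⁻¹) (t ω) (y ω) ∂ν ≤ β) :
    |∫ ω, tr γ (s ω) * x ω ^ 2 ∂ν - ∫ ω, tr γ (t ω) * y ω ^ 2 ∂ν| ≤ γ ^ 2 * (3 / 5 * ε + β) := by
  have h := compare ν ms mt mx my hs ht hx hy (show 0 ≤ γ by linarith)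
    (show 0 < ε ^ 4 by positivity) (show 0 < ε / 40 by positivity) hε bx bY bxy bst bb
  refine h.trans ?_
  have e1 : 2 * (ε ^ 7) ^ 2 / (ε / 40) = 80 * ε ^ 13 := by field_simp; ring
  have e2 : (((ε ^ 2)⁻¹) ^ 4 / ε + ((ε ^ 2)⁻¹) ^ 2 / (ε ^ 4) ^ 2) * (4 * (ε ^ 7) ^ 2)
      = 4 * ε ^ 5 + 4 * ε ^ 2 := by field_simp
  rw [mul_assoc (γ ^ 2) (((ε ^ 2)⁻¹) ^ 4 / ε + _), e1, e2]
  have p2 : ε ^ 2 ≤ 1 / 100 * ε := by nlinarith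
  have p5 : ε ^ 5 ≤ ε ^ 2 := pow_le_pow_of_le_one hε.le (by linarith) (by norm_num)
  have p13 : ε ^ 13 ≤ ε ^ 3 := pow_le_pow_of_le_one hε.le (by linarith) (by norm_num)
  have p3 : ε ^ 3 ≤ 1 / 100 * ε ^ 2 := by
    have : 0 ≤ ε ^ 2 := by positivity
    nlinarith
  have hg : 4 ≤ γ ^ 2 := by nlinarith
  have hge : ε ≤ γ ^ 2 * (ε / 4) := by nlinarith
  have : γ ^ 2 * (8 * (ε / 40) + 80 * ε ^ 13 + (4 * ε ^ 5 + 4 * ε ^ 2) + ε / 4) ≤ γ ^ 2 * (3 / 5 * ε) := by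
    gcongr
    linarith
  linarith

/-- Empirical average. -/
noncomputable def av {m n : ℕ} (a : Fin m → Fin n → ℝ) (Y : (Fin n → ℝ) → ℝ) : ℝ :=
  (1 / (m : ℝ)) * ∑ k, Y (a k)

/-- Uniform probability measure on the sample indices. -/
noncomputable def unif (m : ℕ) : Measure (Fin m) := ((m : ENNReal)⁻¹) • Measure.count

lemma unif_prob {m : ℕ} (hm : 0 < m) : IsProbabilityMeasure (unif m) := by
  constructor
  simp only [unif, Measure.smul_apply, Measure.count_univ, smul_eq_mul]
  simp
  exact ENNReal.inv_mul_cancel (by exact_mod_cast hm.ne') (by simp)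

lemma integral_unif {m n : ℕ} (a : Fin m → Fin n → ℝ) (Y : (Fin n → ℝ) → ℝ) :
    ∫ k, Y (a k) ∂(unif m) = av a Y := by
  rw [unif, integral_smul_measure, integral_count]
  simp [av]

lemma memLp_unif {m : ℕ} (hm : 0 < m) (f : Fin m → ℝ) : MemLp f 2 (unif m) := by
  have := unif_prob hm
  exact MemLp.of_discrete

lemma pop_yb {n : ℕ} (γ : ℝ) {ε : ℝ} (hε : 0 < ε) (hε1 : ε ≤ 1 / (400 * K0)) {z v : Fin n → ℝ}
    (hz : vecNorm z = 1) (hv : vecNorm v = 1) :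
    ∫ a, yb γ (ε ^ 4) ((ε ^ 2)⁻¹) (dotp a z) (dotp a v) ∂(stdGaussianVec n) ≤ ε / 10 := by
  have hK := one_le_K0
  set W : Set (Fin n → ℝ) := {a | |(|dotp a z| - γ)| ≤ ε ^ 4} ∪ {a | (ε ^ 2)⁻¹ < |dotp a v|} with hW
  have m1 : MeasurableSet {x : ℝ | |(|x| - γ)| ≤ ε ^ 4} :=
    measurableSet_le (by fun_prop) (by fun_prop)
  have m2 : MeasurableSet {x : ℝ | (ε ^ 2)⁻¹ < |x|} :=
    measurableSet_lt (by fun_prop) (by fun_prop)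
  have hWm : MeasurableSet W :=
    ((measurable_dotp z) m1).union ((measurable_dotp v) m2)
  have hP : (stdGaussianVec n).real W ≤ 5 * ε ^ 4 := by
    have h1 : (stdGaussianVec n).real {a | |(|dotp a z| - γ)| ≤ ε ^ 4} ≤ 4 * ε ^ 4 := by
      have := window_prob γ (δ := ε ^ 4) (by positivity)
      rw [← law_dotp z hz, map_measureReal_apply (by fun_prop) m1] at this
      exact this
    have h2 : (stdGaussianVec n).real {a | (ε ^ 2)⁻¹ < |dotp a v|} ≤ ε ^ 4 := by
      have := tail_prob (τ := (ε ^ 2)⁻¹) (by positivity)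
      rw [← law_dotp v hv, map_measureReal_apply (by fun_prop) m2] at this
      refine this.trans (le_of_eq ?_)
      field_simp
    exact (measureReal_union_le _ _).trans (by linarith)
  have hpt : ∀ a, yb γ (ε ^ 4) ((ε ^ 2)⁻¹) (dotp a z) (dotp a v) ≤
      ε ^ 2 * (dotp a v) ^ 4 + 1 / (4 * ε ^ 2) * W.indicator (fun _ => (1:ℝ)) a := fun a => by
    unfold yb
    split_ifs with h
    · have : a ∈ W := h
      simp only [Set.indicator, this, if_true]
      have e : ε ^ 2 * (dotp a v) ^ 4 + 1 / (4 * ε ^ 2) * 1 - (dotp a v) ^ 2 =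
        (2 * ε ^ 2 * (dotp a v) ^ 2 - 1) ^ 2 / (4 * ε ^ 2) := by field_simp; ring
      have : 0 ≤ (2 * ε ^ 2 * (dotp a v) ^ 2 - 1) ^ 2 / (4 * ε ^ 2) := by positivity
      linarith
    · have : 0 ≤ W.indicator (fun _ => (1:ℝ)) a := Set.indicator_nonneg (by simp) _
      positivity
  have I1 : Integrable (fun a => ε ^ 2 * (dotp a v) ^ 4) (stdGaussianVec n) :=
    (integrable_dotp hv integrable_pow4).const_mul _
  have I2 : Integrable (fun a => 1 / (4 * ε ^ 2) * W.indicator (fun _ => (1:ℝ)) a) (stdGaussianVec n) :=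
    ((integrable_const _).indicator hWm).const_mul _
  have I0 : Integrable (fun a => yb γ (ε ^ 4) ((ε ^ 2)⁻¹) (dotp a z) (dotp a v)) (stdGaussianVec n) :=
    integrable_Y hv (measurable_yb (by fun_prop) (by fun_prop) _ _ _) (fun a => by
      rw [abs_of_nonneg (yb_nonneg _ _ _ _ _)]; exact yb_le _ _ _ _ _)
  have h := integral_mono I0 (I1.add I2) hpt
  have e : ∫ a, (ε ^ 2 * (dotp a v) ^ 4 + 1 / (4 * ε ^ 2) * W.indicator (fun _ => (1:ℝ)) a) ∂(stdGaussianVec n)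
     = ε ^ 2 * (∫ x : ℝ, x ^ 4 ∂(gaussianReal 0 1)) + 1 / (4 * ε ^ 2) * (stdGaussianVec n).real W := by
    rw [integral_add I1 I2, integral_const_mul, integral_const_mul,
      integral_dotp hv (g := fun x => x ^ 4) (by fun_prop), integral_indicator hWm]
    simp
  have h' : _ ≤ ε ^ 2 * (∫ x : ℝ, x ^ 4 ∂(gaussianReal 0 1)) + 1 / (4 * ε ^ 2) * (stdGaussianVec n).real W :=
    h.trans (le_of_eq e)
  refine h'.trans ?_
  have b1 : ε ^ 2 * (∫ x : ℝ, x ^ 4 ∂(gaussianReal 0 1)) ≤ ε ^ 2 * (32 * K0) := by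
    gcongr; exact integral_pow4_le
  have b2 : 1 / (4 * ε ^ 2) * (stdGaussianVec n).real W ≤ 5 / 4 * ε ^ 2 := by
    calc _ ≤ 1 / (4 * ε ^ 2) * (5 * ε ^ 4) := by gcongr
      _ = _ := by field_simp
  rw [le_div_iff₀ (by positivity)] at hε1
  have b3 : ε ^ 2 * (400 * K0) ≤ ε := by nlinarith
  nlinarith [sq_nonneg ε]

lemma av_nonneg {m n : ℕ} {a : Fin m → Fin n → ℝ} {Y : (Fin n → ℝ) → ℝ} (h : ∀ b, 0 ≤ Y b) :
    0 ≤ av a Y := by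
  unfold av
  have : 0 ≤ ∑ k, Y (a k) := Finset.sum_nonneg fun k _ => h _
  positivity

lemma continuous_vecNorm {n : ℕ} : Continuous (vecNorm : (Fin n → ℝ) → ℝ) := by
  unfold vecNorm; fun_prop

lemma vecNorm_nonneg {n : ℕ} (v : Fin n → ℝ) : 0 ≤ vecNorm v := Real.sqrt_nonneg _

lemma vecNorm_smul {n : ℕ} (c : ℝ) (v : Fin n → ℝ) : vecNorm (c • v) = |c| * vecNorm v := by
  rw [vecNorm_eq, vecNorm_eq, WithLp.toLp_smul, norm_smul, Real.norm_eq_abs]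

lemma vecNorm_eq_zero {n : ℕ} {v : Fin n → ℝ} : vecNorm v = 0 ↔ v = 0 := by
  rw [vecNorm_eq, norm_eq_zero, WithLp.toLp_eq_zero]

lemma exists_unit {n : ℕ} {v : Fin n → ℝ} (h : v ≠ 0) :
    ∃ u : Fin n → ℝ, vecNorm u = 1 ∧ v = vecNorm v • u := by
  have h0 : vecNorm v ≠ 0 := fun h' => h (vecNorm_eq_zero.1 h')
  refine ⟨(vecNorm v)⁻¹ • v, ?_, ?_⟩
  · rw [vecNorm_smul, abs_of_nonneg (inv_nonneg.2 (vecNorm_nonneg v)), inv_mul_cancel₀ h0]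
  · rw [smul_smul, mul_inv_cancel₀ h0, one_smul]

lemma av_smul {m n : ℕ} (a : Fin m → Fin n → ℝ) (c : ℝ) (v : Fin n → ℝ) :
    av a (fun b => dotp b (c • v) ^ 2) = c ^ 2 * av a (fun b => dotp b v ^ 2) := by
  simp only [av, dotp_smul_right, mul_pow, ← Finset.mul_sum]; ring

lemma op_bound {m n : ℕ} (hn : 0 < n) (a : Fin m → Fin n → ℝ) (N : Finset (Fin n → ℝ)) {η : ℝ}
    (hη1 : η ≤ 1 / 4)
    (hcov : ∀ x : Fin n → ℝ, vecNorm x = 1 → ∃ c ∈ N, vecNorm (x - c) ≤ η)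
    (hN : ∀ c ∈ N, av a (fun b => dotp b c ^ 2) ≤ 3 / 2) (u : Fin n → ℝ) :
    av a (fun b => dotp b u ^ 2) ≤ 4 * vecNorm u ^ 2 := by
  set f : (Fin n → ℝ) → ℝ := fun u => av a (fun b => dotp b u ^ 2) with hf
  have hfc : Continuous f := by
    simp only [hf, av, dotp]; fun_prop
  have hcomp : IsCompact {u : Fin n → ℝ | vecNorm u = 1} := by
    have h1 : IsClosed {u : Fin n → ℝ | vecNorm u = 1} := isClosed_eq continuous_vecNorm continuous_const
    refine (isCompact_closedBall (0 : Fin n → ℝ) 1).of_isClosed_subset h1 fun u hu => ?_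
    rw [mem_closedBall_zero_iff, pi_norm_le_iff_of_nonneg zero_le_one]
    intro i
    have hu' : vecNorm u = 1 := hu
    rw [vecNorm_eq] at hu'
    have := PiLp.norm_apply_le (WithLp.toLp 2 u : EuclideanSpace ℝ (Fin n)) i
    rw [hu'] at this; exact this
  have hne : {u : Fin n → ℝ | vecNorm u = 1}.Nonempty := by
    obtain ⟨u, hu, -⟩ := exists_unit (v := (fun _ => 1 : Fin n → ℝ)) (fun h => by
      have := congrFun h ⟨0, hn⟩; simp at this)
    exact ⟨u, hu⟩
  obtain ⟨x, hx, hmax⟩ := hcomp.exists_isMaxOn hne hfc.continuousOn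
  have hx1 : vecNorm x = 1 := hx
  have hsc : ∀ u, f u ≤ f x * vecNorm u ^ 2 := fun u => by
    by_cases hu : u = 0
    · have : f u = 0 := by simp [hf, av, dotp, hu]
      rw [this, hu, vecNorm_eq_zero.2 rfl]; simp
    · obtain ⟨w, hw, hw2⟩ := exists_unit hu
      have : f w ≤ f x := hmax hw
      conv_lhs => rw [hw2]
      simp only [hf] at this ⊢
      rw [av_smul, mul_comm]
      gcongr
  obtain ⟨c, hc, hxc⟩ := hcov x hx1
  have hsplit : f x ≤ 2 * f c + 2 * f (x - c) := by
    have hs : ∑ k, dotp (a k) x ^ 2 ≤ 2 * ∑ k, dotp (a k) c ^ 2 + 2 * ∑ k, dotp (a k) (x - c) ^ 2 := by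
      rw [Finset.mul_sum, Finset.mul_sum, ← Finset.sum_add_distrib]
      refine Finset.sum_le_sum fun k _ => ?_
      rw [dotp_sub_right]
      nlinarith [sq_nonneg (dotp (a k) x - 2 * dotp (a k) c)]
    have hm0 : (0:ℝ) ≤ 1 / (m:ℝ) := by positivity
    have := mul_le_mul_of_nonneg_left hs hm0
    simp only [hf, av]
    linarith
  have h3 : vecNorm (x - c) ^ 2 ≤ 1 / 16 := by
    have := vecNorm_nonneg (x - c)
    nlinarith
  have hfx : 0 ≤ f x := av_nonneg fun b => sq_nonneg _
  have h4 := hsc (x - c)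
  have h5 := hN c hc
  have h6 : f x ≤ 4 := by
    have : f x * vecNorm (x - c) ^ 2 ≤ f x * (1 / 16) := by gcongr
    have h5' : f c ≤ 3 / 2 := h5
    linarith
  refine (hsc u).trans ?_
  gcongr

lemma polar {n : ℕ} (Q : (Fin n → ℝ) → (Fin n → ℝ) → ℝ) {κ : ℝ}
    (hsmul : ∀ c d v w, Q (c • v) (d • w) = c * d * Q v w)
    (hpol : ∀ v w, 4 * Q v w = Q (v + w) (v + w) - Q (v - w) (v - w))
    (hq : ∀ v, vecNorm v = 1 → |Q v v| ≤ κ) (v w : Fin n → ℝ) :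
    |Q v w| ≤ κ * vecNorm v * vecNorm w := by
  have z1 : ∀ w, Q 0 w = 0 := fun w => by
    have := hsmul 0 1 0 w; simpa using this
  have z2 : ∀ w, Q w 0 = 0 := fun w => by
    have := hsmul 1 0 w 0; simpa using this
  have hq' : ∀ v, |Q v v| ≤ κ * vecNorm v ^ 2 := fun v => by
    by_cases hv : v = 0
    · rw [hv, z1, vecNorm_eq_zero.2 rfl]; simp
    · obtain ⟨u, hu, hv2⟩ := exists_unit hv
      have := hq u hu
      conv_lhs => rw [hv2]
      rw [hsmul, abs_mul, abs_mul_self, mul_comm, sq]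
      exact mul_le_mul_of_nonneg_right this (mul_self_nonneg _)
  by_cases hv : v = 0
  · rw [hv, z1, vecNorm_eq_zero.2 rfl]; simp
  by_cases hw : w = 0
  · rw [hw, z2, vecNorm_eq_zero.2 rfl]; simp
  obtain ⟨v', hv1, hv2⟩ := exists_unit hv
  obtain ⟨w', hw1, hw2⟩ := exists_unit hw
  have hpar : vecNorm (v' + w') ^ 2 + vecNorm (v' - w') ^ 2 = 4 := by
    have := parallelogram_law_with_norm ℝ (WithLp.toLp 2 v' : EuclideanSpace ℝ (Fin n)) (WithLp.toLp 2 w')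
    rw [← WithLp.toLp_add, ← WithLp.toLp_sub, ← vecNorm_eq, ← vecNorm_eq, ← vecNorm_eq, ← vecNorm_eq, hv1, hw1] at this
    nlinarith
  have hQ : |Q v' w'| ≤ κ := by
    have h1 := hq' (v' + w')
    have h2 := hq' (v' - w')
    have h3 : |4 * Q v' w'| ≤ κ * 4 := by
      rw [hpol, ← hpar, mul_add]
      exact (abs_sub _ _).trans (add_le_add h1 h2)
    rw [abs_mul, abs_of_pos (by norm_num : (0:ℝ) < 4)] at h3
    linarith
  have hn1 := vecNorm_nonneg v
  have hn2 := vecNorm_nonneg w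
  conv_lhs => rw [hv2, hw2]
  rw [hsmul, abs_mul, abs_of_nonneg (mul_nonneg hn1 hn2)]
  calc _ ≤ vecNorm v * vecNorm w * κ := mul_le_mul_of_nonneg_left hQ (mul_nonneg hn1 hn2)
    _ = _ := by ring

/-- Deviation of the empirical average from the mean. -/
noncomputable def dev {m n : ℕ} (a : Fin m → Fin n → ℝ) (Y : (Fin n → ℝ) → ℝ) : ℝ :=
  |av a Y - ∫ b, Y b ∂(stdGaussianVec n)|

/-- First test function. -/
noncomputable def fone {n : ℕ} (γ : ℝ) (z v : Fin n → ℝ) (b : Fin n → ℝ) : ℝ :=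
  (γ ^ 2)⁻¹ * (tr γ (dotp b z) * dotp b v ^ 2)

/-- Second test function. -/
noncomputable def ftwo {n : ℕ} (γ ε : ℝ) (z v : Fin n → ℝ) (b : Fin n → ℝ) : ℝ :=
  yb γ (ε ^ 4) ((ε ^ 2)⁻¹) (dotp b z) (dotp b v)

/-- Third test function. -/
noncomputable def fthree {n : ℕ} (v : Fin n → ℝ) (b : Fin n → ℝ) : ℝ := dotp b v ^ 2

lemma determ {m n : ℕ} (hm : 0 < m) (hn : 0 < n) {γ ε : ℝ} (hγ : 2 ≤ γ) (hε : 0 < ε)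
    (hε1 : ε ≤ 1 / (400 * K0)) (N : Finset (Fin n → ℝ)) (hN1 : ∀ c ∈ N, vecNorm c = 1)
    (hcov : ∀ x : Fin n → ℝ, vecNorm x = 1 → ∃ c ∈ N, vecNorm (x - c) ≤ ε ^ 7)
    (a : Fin m → Fin n → ℝ)
    (g1 : ∀ z ∈ N, ∀ v ∈ N, dev a (fone γ z v) ≤ ε / 10)
    (g2 : ∀ z ∈ N, ∀ v ∈ N, dev a (ftwo γ ε z v) ≤ ε / 10)
    (g3 : ∀ v ∈ N, dev a (fthree v) ≤ ε / 10)
    {z v : Fin n → ℝ} (hz : vecNorm z = 1) (hv : vecNorm v = 1) :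
    |av a (fun b => tr γ (dotp b z) * dotp b v ^ 2)
      - ∫ b, tr γ (dotp b z) * dotp b v ^ 2 ∂(stdGaussianVec n)| ≤ γ ^ 4 * ε := by
  have hK := one_le_K0
  have hε2 : ε ≤ 1 / 100 := hε1.trans (by
    apply one_div_le_one_div_of_le <;> linarith)
  have hη : ε ^ 7 ≤ 1 / 4 := by
    have : ε ^ 7 ≤ ε ^ 1 := pow_le_pow_of_le_one hε.le (by linarith) (by norm_num)
    linarith
  have hop := op_bound hn a N hη hcov (fun c hc => by
    have h := (abs_le.1 (g3 c hc)).2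
    have e : ∫ b, fthree c b ∂(stdGaussianVec n) = 1 := by
      simp only [fthree]; rw [second_moment, hN1 c hc]; norm_num
    rw [e] at h
    have : av a (fthree c) ≤ 3 / 2 := by linarith
    exact this)
  obtain ⟨z0, hz0, hzz⟩ := hcov z hz
  obtain ⟨v0, hv0, hvv⟩ := hcov v hv
  have hzn := hN1 z0 hz0
  have hvn := hN1 v0 hv0
  have hzz2 : vecNorm (z - z0) ^ 2 ≤ (ε ^ 7) ^ 2 := pow_le_pow_left₀ (vecNorm_nonneg _) hzz 2
  have hvv2 : vecNorm (v - v0) ^ 2 ≤ (ε ^ 7) ^ 2 := pow_le_pow_left₀ (vecNorm_nonneg _) hvv 2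
  have hη0 : 0 ≤ (ε ^ 7) ^ 2 := by positivity
  have hpop := pop_yb γ hε hε1 hzn hvn
  -- population comparison
  have c1 := compare' (stdGaussianVec n) (measurable_dotp z) (measurable_dotp z0) (measurable_dotp v)
    (measurable_dotp v0) (memLp_dotp z) (memLp_dotp z0) (memLp_dotp v) (memLp_dotp v0) hγ hε hε2
    (by rw [second_moment, hv]; norm_num) (by rw [second_moment, hvn]; norm_num)
    (by simp only [← dotp_sub_right]; rw [second_moment]; linarith)
    (by simp only [← dotp_sub_right]; rw [second_moment]; linarith) hpop
  -- empirical comparison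
  have hyb : av a (ftwo γ ε z0 v0) ≤ ε / 5 := by
    have h := (abs_le.1 (g2 z0 hz0 v0 hv0)).2
    have : ∫ b, ftwo γ ε z0 v0 b ∂(stdGaussianVec n) ≤ ε / 10 := hpop
    linarith
  have := unif_prob hm
  have c2 := compare' (unif m) (s := fun k => dotp (a k) z) (t := fun k => dotp (a k) z0)
    (x := fun k => dotp (a k) v) (y := fun k => dotp (a k) v0) (measurable_of_countable _)
    (measurable_of_countable _) (measurable_of_countable _) (measurable_of_countable _)
    (memLp_unif hm _) (memLp_unif hm _) (memLp_unif hm _) (memLp_unif hm _) hγ hε hε2 (β := ε / 5)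
    (by
      rw [integral_unif a (fun b => dotp b v ^ 2)]
      refine (hop v).trans ?_; rw [hv]; norm_num)
    (by
      rw [integral_unif a (fun b => dotp b v0 ^ 2)]
      refine (hop v0).trans ?_; rw [hvn]; norm_num)
    (by
      simp only [← dotp_sub_right]
      rw [integral_unif a (fun b => dotp b (v - v0) ^ 2)]
      refine (hop _).trans ?_; linarith)
    (by
      simp only [← dotp_sub_right]
      rw [integral_unif a (fun b => dotp b (z - z0) ^ 2)]
      refine (hop _).trans ?_; linarith)
    (by
      rw [integral_unif a (fun b => yb γ (ε ^ 4) ((ε ^ 2)⁻¹) (dotp b z0) (dotp b v0))]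
      exact hyb)
  rw [integral_unif a (fun b => tr γ (dotp b z) * dotp b v ^ 2),
    integral_unif a (fun b => tr γ (dotp b z0) * dotp b v0 ^ 2)] at c2
  have hγ2 : 4 ≤ γ ^ 2 := by nlinarith
  have c3 : |av a (fun b => tr γ (dotp b z0) * dotp b v0 ^ 2)
      - ∫ b, tr γ (dotp b z0) * dotp b v0 ^ 2 ∂(stdGaussianVec n)| ≤ γ ^ 2 * (ε / 10) := by
    have h := g1 z0 hz0 v0 hv0
    have e1 : av a (fone γ z0 v0) = (γ ^ 2)⁻¹ * av a (fun b => tr γ (dotp b z0) * dotp b v0 ^ 2) := by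
      simp only [av, fone, ← Finset.mul_sum]; ring
    have e2 : ∫ b, fone γ z0 v0 b ∂(stdGaussianVec n) =
      (γ ^ 2)⁻¹ * ∫ b, tr γ (dotp b z0) * dotp b v0 ^ 2 ∂(stdGaussianVec n) := by
      simp only [fone]; rw [integral_const_mul]
    rw [dev, e1, e2, ← mul_sub, abs_mul, abs_of_pos (by positivity)] at h
    rwa [inv_mul_le_iff₀ (by positivity)] at h
  have key : γ ^ 2 * (3 / 5 * ε + ε / 10) + γ ^ 2 * (3 / 5 * ε + ε / 5) + γ ^ 2 * (ε / 10) ≤ γ ^ 4 * ε := by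
    have : 4 * (γ ^ 2 * ε) ≤ γ ^ 2 * (γ ^ 2 * ε) := by gcongr
    have h0 : 0 ≤ γ ^ 2 * ε := by positivity
    nlinarith
  rw [abs_le] at c1 c2 c3 ⊢
  constructor <;> linarith [c1.1, c1.2, c2.1, c2.2, c3.1, c3.2]

lemma bad_prob {m n : ℕ} (hm : 0 < m) {ε : ℝ} (hε : 0 < ε) (hε1 : ε ≤ 1) {v : Fin n → ℝ}
    (hv : vecNorm v = 1) {Y : (Fin n → ℝ) → ℝ} (hY : Measurable Y)
    (hYb : ∀ b, |Y b| ≤ (dotp b v) ^ 2) :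
    (sampleMeasure m n).real {a | ε / 10 < dev a Y} ≤ 2 * Real.exp (-(1 / (409600 * K0) * m * ε ^ 2)) := by
  have h := tail_two hm hv hY hYb (t := ε / 10) (by positivity) (by linarith)
  have hK := one_le_K0
  have e : 1 / (4096 * K0) * m * (ε / 10) ^ 2 = 1 / (409600 * K0) * m * ε ^ 2 := by
    field_simp; ring
  rw [e] at h
  refine le_trans (measureReal_mono fun a ha => ?_) h
  have ha2 : ε / 10 < dev a Y := ha
  exact ha2.le

lemma fone_abs {n : ℕ} {γ : ℝ} (hγ : 2 ≤ γ) (z v b : Fin n → ℝ) : |fone γ z v b| ≤ dotp b v ^ 2 := by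
  have h1 := tr_nonneg γ (dotp b z)
  have h2 := tr_le γ (dotp b z)
  unfold fone
  rw [abs_of_nonneg (by positivity), inv_mul_le_iff₀ (by positivity)]
  gcongr

lemma measurable_fone {n : ℕ} (γ : ℝ) (z v : Fin n → ℝ) : Measurable (fone γ z v) := by
  have h1 : Measurable fun b : Fin n → ℝ => tr γ (dotp b z) := (measurable_tr γ).comp (measurable_dotp z)
  have h2 := measurable_dotp v
  unfold fone
  exact (h1.mul (h2.pow_const 2)).const_mul _

lemma good_prob {m n : ℕ} (hm : 0 < m) {γ ε : ℝ} (hγ : 2 ≤ γ) (hε : 0 < ε) (hε1 : ε ≤ 1)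
    (N : Finset (Fin n → ℝ)) (hN1 : ∀ c ∈ N, vecNorm c = 1)
    (S : Set (Fin m → Fin n → ℝ))
    (hS : ∀ a, (∀ z ∈ N, ∀ v ∈ N, dev a (fone γ z v) ≤ ε / 10 ∧ dev a (ftwo γ ε z v) ≤ ε / 10 ∧
      dev a (fthree v) ≤ ε / 10) → a ∈ S) :
    (sampleMeasure m n).real Sᶜ ≤
      (N.card : ℝ) ^ 2 * (6 * Real.exp (-(1 / (409600 * K0) * m * ε ^ 2))) := by
  set p := Real.exp (-(1 / (409600 * K0) * m * ε ^ 2)) with hp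
  let B : (Fin n → ℝ) × (Fin n → ℝ) → Set (Fin m → Fin n → ℝ) := fun q =>
    {a | ε / 10 < dev a (fone γ q.1 q.2)} ∪ ({a | ε / 10 < dev a (ftwo γ ε q.1 q.2)} ∪
      {a | ε / 10 < dev a (fthree q.2)})
  have hsub : Sᶜ ⊆ ⋃ q ∈ N ×ˢ N, B q := by
    intro a ha
    by_contra hcon
    apply ha
    apply hS
    intro z hz v hv
    have : a ∉ B (z, v) := fun h => hcon (by
      simp only [Set.mem_iUnion]
      exact ⟨(z, v), Finset.mem_product.2 ⟨hz, hv⟩, h⟩)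
    refine ⟨?_, ?_, ?_⟩ <;> refine not_lt.1 fun h => this ?_
    · exact Or.inl h
    · exact Or.inr (Or.inl h)
    · exact Or.inr (Or.inr h)
  have hB : ∀ q ∈ N ×ˢ N, (sampleMeasure m n).real (B q) ≤ 6 * p := fun q hq => by
    have hv := hN1 q.2 (Finset.mem_product.1 hq).2
    have b1 := bad_prob hm hε hε1 hv (measurable_fone γ q.1 q.2) (fone_abs hγ q.1 q.2)
    have b2 := bad_prob hm hε hε1 hv (Y := ftwo γ ε q.1 q.2)
      (measurable_yb (measurable_dotp q.1) (measurable_dotp q.2) _ _ _) (fun b => by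
        unfold ftwo
        rw [abs_of_nonneg (yb_nonneg _ _ _ _ _)]; exact yb_le _ _ _ _ _)
    have b3 := bad_prob hm hε hε1 hv (Y := fthree q.2) ((measurable_dotp q.2).pow_const 2) (fun b => by
        unfold fthree
        rw [abs_of_nonneg (sq_nonneg _)])
    refine (measureReal_union_le _ _).trans ?_
    have := measureReal_union_le (μ := sampleMeasure m n) {a | ε / 10 < dev a (ftwo γ ε q.1 q.2)}
      {a | ε / 10 < dev a (fthree q.2)}
    linarith
  calc _ ≤ (sampleMeasure m n).real (⋃ q ∈ N ×ˢ N, B q) :=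
        measureReal_mono hsub (measure_ne_top _ _)
    _ ≤ ∑ q ∈ N ×ˢ N, (sampleMeasure m n).real (B q) := measureReal_biUnion_finset_le _ _
    _ ≤ ∑ q ∈ N ×ˢ N, 6 * p := Finset.sum_le_sum hB
    _ = _ := by
      rw [Finset.sum_const, Finset.card_product, nsmul_eq_mul]; push_cast; ring

lemma numeric {K ε : ℝ} (hK : 1 ≤ K) (hε : 0 < ε) (hε1 : ε < 1 / (400 * K)) {n m : ℕ} (hn : 0 < n)
    {M : ℝ} (hM0 : 0 ≤ M) (hM : M ≤ (3 / ε ^ 7) ^ n)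
    (hmn : (100 * 409600 * K) * ε⁻¹ ^ 2 * Real.log ε⁻¹ * (n : ℝ) ≤ (m : ℝ)) :
    M ^ 2 * (6 * Real.exp (-(1 / (409600 * K) * m * ε ^ 2))) ≤
      Real.exp (-(1 / (2 * 409600 * K) * m * ε ^ 2)) := by
  set l := Real.log ε⁻¹ with hl
  have hn1 : (1:ℝ) ≤ n := by exact_mod_cast hn
  have hεinv : 400 ≤ ε⁻¹ := by
    rw [le_inv_comm₀ (by norm_num) hε]
    refine hε1.le.trans ?_
    rw [← one_div]
    apply one_div_le_one_div_of_le <;> linarith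
  have hl1 : 1 ≤ l := by
    rw [hl, Real.le_log_iff_exp_le (by positivity)]
    have := Real.exp_one_lt_d9
    linarith
  have hexp : Real.exp l = ε⁻¹ := Real.exp_log (by positivity)
  have h3 : 3 / ε ^ 7 ≤ Real.exp (8 * l) := by
    have : Real.exp (8 * l) = ε⁻¹ ^ 8 := by rw [← hexp, ← Real.exp_nat_mul]; norm_num
    rw [this, div_eq_mul_inv, ← inv_pow]
    have h7 : 0 ≤ ε⁻¹ ^ 7 := by positivity
    nlinarith
  have hM2 : M ^ 2 ≤ Real.exp (16 * l * n) := by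
    calc M ^ 2 ≤ ((Real.exp (8 * l)) ^ n) ^ 2 := by
          refine pow_le_pow_left₀ hM0 (hM.trans ?_) 2
          exact pow_le_pow_left₀ (by positivity) h3 n
      _ = _ := by
          rw [← Real.exp_nat_mul, ← Real.exp_nat_mul]; congr 1; push_cast; ring
  have h6 : (6:ℝ) ≤ Real.exp (2 * l * n) := by
    have : Real.exp 2 ≤ Real.exp (2 * l * n) := by
      apply Real.exp_le_exp.2; nlinarith
    refine le_trans ?_ this
    have h2 : Real.exp 2 = Real.exp 1 ^ 2 := by rw [← Real.exp_nat_mul]; norm_num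
    rw [h2]; have := Real.exp_one_gt_d9; nlinarith
  have hbig : 100 * l * n ≤ 1 / (409600 * K) * m * ε ^ 2 := by
    have := mul_le_mul_of_nonneg_left hmn (show 0 ≤ 1 / (409600 * K) * ε ^ 2 by positivity)
    have e : 1 / (409600 * K) * ε ^ 2 * (100 * 409600 * K * ε⁻¹ ^ 2 * l * n) = 100 * l * n := by
      field_simp
    rw [e] at this; linarith
  have e2 : 1 / (2 * 409600 * K) * m * ε ^ 2 = (1 / (409600 * K) * m * ε ^ 2) / 2 := by
    field_simp
  rw [e2]
  set X := 1 / (409600 * K) * m * ε ^ 2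
  have hln : 0 ≤ l * n := by positivity
  calc M ^ 2 * (6 * Real.exp (-X)) ≤ Real.exp (16 * l * n) * (Real.exp (2 * l * n) * Real.exp (-X)) := by
        gcongr
    _ = Real.exp (16 * l * n + (2 * l * n + -X)) := by rw [Real.exp_add, Real.exp_add]
    _ ≤ _ := by apply Real.exp_le_exp.2; nlinarith

/-- The bilinear form of a matrix. -/
noncomputable def bil {n : ℕ} (v w : Fin n → ℝ) : Matrix (Fin n) (Fin n) ℝ →ₗ[ℝ] ℝ where
  toFun M := ∑ i, ∑ j, v i * M i j * w j
  map_add' M M' := by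
    simp only [Matrix.add_apply, mul_add, add_mul, Finset.sum_add_distrib]
  map_smul' c M := by
    simp only [Matrix.smul_apply, smul_eq_mul, Finset.mul_sum, RingHom.id_apply]
    refine Finset.sum_congr rfl fun i _ => Finset.sum_congr rfl fun j _ => ?_
    ring

lemma bil_vecMulVec {n : ℕ} (v w b : Fin n → ℝ) : bil v w (vecMulVec b b) = dotp b v * dotp b w := by
  simp only [bil, LinearMap.coe_mk, AddHom.coe_mk, vecMulVec_apply, dotp, Finset.sum_mul_sum]
  refine Finset.sum_congr rfl fun i _ => Finset.sum_congr rfl fun j _ => ?_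
  ring

lemma bil_one {n : ℕ} (v w : Fin n → ℝ) : bil v w 1 = dotp v w := by
  simp [bil, dotp, Matrix.one_apply]

/-- The centered quadratic form. -/
noncomputable def qf {m n : ℕ} (a : Fin m → Fin n → ℝ) (γ θ₁ θ₂ : ℝ) (z v w : Fin n → ℝ) : ℝ :=
  av a (fun b => tr γ (dotp b z) * (dotp b v * dotp b w))
    - (θ₁ * (dotp z v * dotp z w) + θ₂ * dotp v w)

lemma qf_smul {m n : ℕ} (a : Fin m → Fin n → ℝ) (γ θ₁ θ₂ : ℝ) (z : Fin n → ℝ) (c d : ℝ)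
    (v w : Fin n → ℝ) : qf a γ θ₁ θ₂ z (c • v) (d • w) = c * d * qf a γ θ₁ θ₂ z v w := by
  have h : dotp (c • v) (d • w) = c * d * dotp v w := by
    rw [dotp_smul_right, dotp_comm, dotp_smul_right, dotp_comm w v]; ring
  have h2 : av a (fun b => tr γ (dotp b z) * (dotp b (c • v) * dotp b (d • w))) =
      c * d * av a (fun b => tr γ (dotp b z) * (dotp b v * dotp b w)) := by
    simp only [av, Finset.mul_sum, dotp_smul_right]
    refine Finset.sum_congr rfl fun i _ => ?_
    ring
  unfold qf
  rw [h, h2, dotp_smul_right, dotp_smul_right]; ring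

lemma qf_pol {m n : ℕ} (a : Fin m → Fin n → ℝ) (γ θ₁ θ₂ : ℝ) (z : Fin n → ℝ)
    (v w : Fin n → ℝ) : 4 * qf a γ θ₁ θ₂ z v w =
      qf a γ θ₁ θ₂ z (v + w) (v + w) - qf a γ θ₁ θ₂ z (v - w) (v - w) := by
  have h : 4 * dotp v w = dotp (v + w) (v + w) - dotp (v - w) (v - w) := by
    simp only [dotp, Finset.mul_sum, ← Finset.sum_sub_distrib, Pi.add_apply, Pi.sub_apply]
    refine Finset.sum_congr rfl fun i _ => ?_
    ring
  have h2 : 4 * av a (fun b => tr γ (dotp b z) * (dotp b v * dotp b w)) =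
      av a (fun b => tr γ (dotp b z) * (dotp b (v + w) * dotp b (v + w))) -
      av a (fun b => tr γ (dotp b z) * (dotp b (v - w) * dotp b (v - w))) := by
    simp only [av, Finset.mul_sum, dotp_add_right, dotp_sub_right, ← Finset.sum_sub_distrib]
    refine Finset.sum_congr rfl fun i _ => ?_
    ring
  have h3 : 4 * (dotp z v * dotp z w) = dotp z (v + w) * dotp z (v + w) - dotp z (v - w) * dotp z (v - w) := by
    rw [dotp_add_right, dotp_sub_right]; ring
  unfold qf
  linear_combination h2 - θ₁ * h3 - θ₂ * h

lemma tr_scale {γ r s : ℝ} (hr : 0 < r) :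
    (if |r * s| ≤ γ * r then (r * s) ^ 2 else 0) = r ^ 2 * tr γ s := by
  have : |r * s| ≤ γ * r ↔ |s| ≤ γ := by
    rw [abs_mul, abs_of_pos hr, mul_comm γ]; exact mul_le_mul_iff_right₀ hr
  unfold tr
  simp only [this]
  split_ifs <;> ring

lemma matrix_form {m n : ℕ} (a : Fin m → Fin n → ℝ) (γ θ₁ θ₂ : ℝ) {r : ℝ} (hr : 0 < r)
    {u : Fin n → ℝ} (hu : vecNorm u = 1) (v w : Fin n → ℝ) :
    ∑ i, ∑ j, v i *
              ((1 / (m : ℝ)) • (∑ k, if |dotp (a k) (r • u)| ≤ γ * vecNorm (r • u) then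
                    (dotp (a k) (r • u))^2 • vecMulVec (a k) (a k)
                  else (0 : Matrix (Fin n) (Fin n) ℝ))
                - (θ₁ • vecMulVec (r • u) (r • u)
                  + (θ₂ * vecNorm (r • u) ^ 2) • (1 : Matrix (Fin n) (Fin n) ℝ))) i j
                * w j = r ^ 2 * qf a γ θ₁ θ₂ u v w := by
  have hn : vecNorm (r • u) = r := by rw [vecNorm_smul, hu, abs_of_pos hr, mul_one]
  change bil v w ((1 / (m : ℝ)) • (∑ k, if |dotp (a k) (r • u)| ≤ γ * vecNorm (r • u) then
                    (dotp (a k) (r • u))^2 • vecMulVec (a k) (a k)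
                  else (0 : Matrix (Fin n) (Fin n) ℝ))
                - (θ₁ • vecMulVec (r • u) (r • u)
                  + (θ₂ * vecNorm (r • u) ^ 2) • (1 : Matrix (Fin n) (Fin n) ℝ))) = _
  have hk : ∀ k, bil v w (if |dotp (a k) (r • u)| ≤ γ * vecNorm (r • u) then
                    (dotp (a k) (r • u))^2 • vecMulVec (a k) (a k)
                  else (0 : Matrix (Fin n) (Fin n) ℝ)) =
      r ^ 2 * (tr γ (dotp (a k) u) * (dotp (a k) v * dotp (a k) w)) := fun k => by
    rw [← mul_assoc, ← tr_scale hr, hn, dotp_smul_right]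
    split_ifs
    · rw [map_smul, bil_vecMulVec, smul_eq_mul]
    · simp
  rw [map_sub, map_add, map_smul, map_smul, map_smul, map_sum, bil_one, bil_vecMulVec,
    Finset.sum_congr rfl fun k _ => hk k, hn, dotp_comm (r • u) v, dotp_comm (r • u) w,
    dotp_smul_right, dotp_smul_right, dotp_comm v u, dotp_comm w u, ← Finset.mul_sum]
  simp only [qf, av, smul_eq_mul]
  ring

end TFM

/-- Uniform concentration of the truncated fourth-moment matrix
`(1/m)∑ₖ (aₖᵀz)² aₖaₖᵀ·1{|aₖᵀz| ≤ γ‖z‖}` around `ϑ₁zzᵀ + ϑ₂‖z‖²I` in spectral norm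
(expressed through the bilinear form against arbitrary vectors `v, w`). -/
theorem truncated_fourth_moment_concentration :
    ∃ c C εbar : ℝ, 0 < c ∧ 0 < C ∧ εbar ∈ Set.Ioo (0:ℝ) 1 ∧
      ∀ γ : ℝ, 2 ≤ γ → ∀ ε : ℝ, 0 < ε → ε < εbar →
      ∀ ϑ₁ ϑ₂ : ℝ,
      ϑ₁ = (∫ t in {s : ℝ | |s| ≤ γ}, t^4 ∂(gaussianReal 0 1))
        - ∫ t in {s : ℝ | |s| ≤ γ}, t^2 ∂(gaussianReal 0 1) →
      ϑ₂ = ∫ t in {s : ℝ | |s| ≤ γ}, t^2 ∂(gaussianReal 0 1) →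
      ∀ n m : ℕ, 0 < n → 0 < m → C * ε⁻¹^2 * Real.log ε⁻¹ * (n : ℝ) ≤ (m : ℝ) →
      sampleMeasure m n {a : Fin m → Fin n → ℝ |
        ∀ z : Fin n → ℝ, ∀ v w : Fin n → ℝ,
          |∑ i, ∑ j, v i *
              ((1 / (m : ℝ)) • (∑ k, if |dotp (a k) z| ≤ γ * vecNorm z then
                    (dotp (a k) z)^2 • vecMulVec (a k) (a k)
                  else (0 : Matrix (Fin n) (Fin n) ℝ))
                - (ϑ₁ • vecMulVec z z + (ϑ₂ * vecNorm z ^ 2) • (1 : Matrix (Fin n) (Fin n) ℝ))) i j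
                * w j|
            ≤ (10 * γ^3 * Real.exp (-(0.49 * γ^2))
                + (10 * γ^2 / ε) * Real.exp (-(0.49 * ε⁻¹^2)) + γ^4 * ε)
              * vecNorm z ^ 2 * vecNorm v * vecNorm w}
        ≥ ENNReal.ofReal (1 - Real.exp (-(c * (m : ℝ) * ε^2))) := by
  have hK := TFM.one_le_K0
  refine ⟨1 / (2 * 409600 * TFM.K0), 100 * 409600 * TFM.K0, 1 / (400 * TFM.K0), by positivity,
    by positivity, ⟨by positivity, ?_⟩, ?_⟩
  · rw [div_lt_one (by positivity)]; linarith
  intro γ hγ ε hε hεb ϑ₁ ϑ₂ h₁ h₂ n m hn hm hmn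
  have hε1 : ε ≤ 1 := hεb.le.trans (by rw [div_le_one (by positivity)]; linarith)
  obtain ⟨N, hN1, hNc, hcov⟩ := TFM.exists_net n (η := ε ^ 7) (by positivity)
    (pow_le_one₀ hε.le hε1)
  set S := {a : Fin m → Fin n → ℝ |
        ∀ z : Fin n → ℝ, ∀ v w : Fin n → ℝ,
          |∑ i, ∑ j, v i *
              ((1 / (m : ℝ)) • (∑ k, if |dotp (a k) z| ≤ γ * vecNorm z then
                    (dotp (a k) z)^2 • vecMulVec (a k) (a k)
                  else (0 : Matrix (Fin n) (Fin n) ℝ))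
                - (ϑ₁ • vecMulVec z z + (ϑ₂ * vecNorm z ^ 2) • (1 : Matrix (Fin n) (Fin n) ℝ))) i j
                * w j|
            ≤ (10 * γ^3 * Real.exp (-(0.49 * γ^2))
                + (10 * γ^2 / ε) * Real.exp (-(0.49 * ε⁻¹^2)) + γ^4 * ε)
              * vecNorm z ^ 2 * vecNorm v * vecNorm w} with hSdef
  have hS : ∀ a, (∀ z ∈ N, ∀ v ∈ N, TFM.dev a (TFM.fone γ z v) ≤ ε / 10 ∧
      TFM.dev a (TFM.ftwo γ ε z v) ≤ ε / 10 ∧ TFM.dev a (TFM.fthree v) ≤ ε / 10) → a ∈ S := by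
    intro a hG
    have hdet : ∀ z v : Fin n → ℝ, vecNorm z = 1 → vecNorm v = 1 →
        |TFM.qf a γ ϑ₁ ϑ₂ z v v| ≤ γ ^ 4 * ε := fun z v hz hv => by
      have h := TFM.determ hm hn hγ hε hεb.le N hN1 hcov a
        (fun z hz v hv => (hG z hz v hv).1) (fun z hz v hv => (hG z hz v hv).2.1)
        (fun v hv => (hG v hv v hv).2.2) hz hv
      rw [TFM.population γ z v hz hv, ← h₁, ← h₂] at h
      unfold TFM.qf
      rw [← TFM.vecNorm_sq v, hv]
      simpa only [sq, one_mul, mul_one] using h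
    rw [hSdef, Set.mem_ofPred_eq]
    intro z v w
    by_cases hz0 : z = 0
    · have e0 : vecNorm z = 0 := TFM.vecNorm_eq_zero.2 hz0
      rw [e0, hz0]
      simp [dotp]
    · obtain ⟨u, hu, hzu⟩ := TFM.exists_unit hz0
      have hr : 0 < vecNorm z := lt_of_le_of_ne (TFM.vecNorm_nonneg z)
        (fun h => hz0 (TFM.vecNorm_eq_zero.1 h.symm))
      have hform := TFM.matrix_form a γ ϑ₁ ϑ₂ hr hu v w
      rw [← hzu] at hform
      rw [hform, abs_mul, abs_of_nonneg (sq_nonneg (vecNorm z))]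
      have hp := TFM.polar (TFM.qf a γ ϑ₁ ϑ₂ u) (κ := γ ^ 4 * ε) (TFM.qf_smul a γ ϑ₁ ϑ₂ u)
        (TFM.qf_pol a γ ϑ₁ ϑ₂ u) (fun v hv => hdet u v hu hv) v w
      have hv0 := TFM.vecNorm_nonneg v
      have hw0 := TFM.vecNorm_nonneg w
      have hγ0 : 0 ≤ γ := by linarith
      have hx : γ ^ 4 * ε ≤ 10 * γ^3 * Real.exp (-(0.49 * γ^2))
                + (10 * γ^2 / ε) * Real.exp (-(0.49 * ε⁻¹^2)) + γ^4 * ε := by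
        have t1 : 0 ≤ 10 * γ^3 * Real.exp (-(0.49 * γ^2)) := by positivity
        have t2 : 0 ≤ (10 * γ^2 / ε) * Real.exp (-(0.49 * ε⁻¹^2)) := by positivity
        linarith
      calc vecNorm z ^ 2 * |TFM.qf a γ ϑ₁ ϑ₂ u v w|
          ≤ vecNorm z ^ 2 * (γ ^ 4 * ε * vecNorm v * vecNorm w) := by gcongr
        _ = γ ^ 4 * ε * vecNorm z ^ 2 * vecNorm v * vecNorm w := by ring
        _ ≤ _ := by gcongr
  have hbad := (TFM.good_prob hm hγ hε hε1 N hN1 S hS).trans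
    (TFM.numeric hK hε hεb hn (Nat.cast_nonneg _) hNc hmn)
  have htot : 1 ≤ (sampleMeasure m n).real S + (sampleMeasure m n).real Sᶜ := by
    have := measureReal_union_le (μ := sampleMeasure m n) S Sᶜ
    rw [Set.union_compl_self] at this
    simpa using this
  rw [ge_iff_le, ENNReal.ofReal_le_iff_le_toReal (measure_ne_top _ _)]
  change _ ≤ (sampleMeasure m n).real S
  linarith
end
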